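/- arXiv:1405.4537 — 10 statements merged into one kernel-verified Lean document; each statement's English description precedes it below -/
import Mathlib

section
/- Let F be a real Banach space, let A : ℝ^d → (F →L F) be a linear map into the bounded linear operators on F, let γ : [a,b] → ℝ^d be a C¹ path, and let y : [a,b] → F be differentiable with y'(t) = A(γ'(t))(y(t)) for all t ∈ [a,b]. Then y(b) = Σ_{n=0}^∞ Σ_{w=(i₁,…,iₙ)} S^w_{a,b}(γ) · (A(e_{iₙ}) ∘ ⋯ ∘ A(e_{i₁}))(y(a)), where the sum over n = 0 gives y(a), the inner sum is over all words of length n over {1,…,d}, e_i denotes the i-th standard basis vector of ℝ^d, and the series converges absolutely in F. -/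
open MeasureTheory intervalIntegral Set Filter

/-- Signature coefficients of a path, indexed by words over `Fin d`. -/
noncomputable def sig {d : ℕ} (γ : ℝ → EuclideanSpace ℝ (Fin d)) :
    List (Fin d) → ℝ → ℝ → ℝ
  | [], _, _ => 1
  | i :: w, s, t => ∫ u in s..t, deriv γ u i * sig γ w u t

/-- Given `A` sending vectors of `ℝ^d` to bounded operators on `F`, the operator
`A(e_{iₙ}) ∘ ⋯ ∘ A(e_{i₁})` associated to the word `(i₁,…,iₙ)`. -/
noncomputable def wordOp {d : ℕ} {F : Type*} [NormedAddCommGroup F] [NormedSpace ℝ F]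
    (A : EuclideanSpace ℝ (Fin d) → (F →L[ℝ] F)) : List (Fin d) → (F →L[ℝ] F)
  | [] => ContinuousLinearMap.id ℝ F
  | i :: w => (wordOp A w).comp (A (EuclideanSpace.single i 1))

theorem continuous_sig {d : ℕ} {γ : ℝ → EuclideanSpace ℝ (Fin d)} (hγ : Continuous (deriv γ))
    (w : List (Fin d)) (b : ℝ) : Continuous fun s => sig γ w s b := by
  induction w with
  | nil => simpa [sig] using continuous_const
  | cons i w ih =>
    have hc : Continuous fun u => deriv γ u i * sig γ w u b := by fun_prop
    have h : (fun s => sig γ (i :: w) s b) = fun s => -∫ u in b..s, deriv γ u i * sig γ w u b := by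
      funext s
      rw [sig, intervalIntegral.integral_symm]
    rw [h]
    exact (intervalIntegral.continuous_primitive (fun x y => hc.intervalIntegrable x y) b).neg

theorem hasDerivAt_sig_cons {d : ℕ} {γ : ℝ → EuclideanSpace ℝ (Fin d)}
    (hγ : Continuous (deriv γ)) (i : Fin d) (w : List (Fin d)) (s b : ℝ) :
    HasDerivAt (fun s => sig γ (i :: w) s b) (-(deriv γ s i * sig γ w s b)) s := by
  have hw := continuous_sig hγ w b
  have hc : Continuous fun u => deriv γ u i * sig γ w u b := by fun_prop
  exact intervalIntegral.integral_hasDerivAt_left (hc.intervalIntegrable s b)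
    hc.stronglyMeasurable.stronglyMeasurableAtFilter hc.continuousAt

/-- The level-`n` part of the signature over `[s, b]`, evaluated on the operators `A(e_i)`. -/
noncomputable def sigLevel {d : ℕ} {F : Type*} [NormedAddCommGroup F] [NormedSpace ℝ F]
    (A : EuclideanSpace ℝ (Fin d) → (F →L[ℝ] F)) (γ : ℝ → EuclideanSpace ℝ (Fin d))
    (b : ℝ) (n : ℕ) (s : ℝ) : F →L[ℝ] F :=
  ∑ f : Fin n → Fin d, sig γ (List.ofFn f) s b • wordOp A (List.ofFn f)

section sigLevel

variable {d : ℕ} {F : Type*} [NormedAddCommGroup F] [NormedSpace ℝ F]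

theorem sigLevel_zero (A : EuclideanSpace ℝ (Fin d) → (F →L[ℝ] F))
    (γ : ℝ → EuclideanSpace ℝ (Fin d)) (b s : ℝ) :
    sigLevel A γ b 0 s = ContinuousLinearMap.id ℝ F := by
  simp [sigLevel, sig, wordOp]

theorem sigLevel_succ (A : EuclideanSpace ℝ (Fin d) → (F →L[ℝ] F))
    (γ : ℝ → EuclideanSpace ℝ (Fin d)) (b : ℝ) (n : ℕ) (s : ℝ) :
    sigLevel A γ b (n + 1) s = ∑ i : Fin d, ∑ f : Fin n → Fin d,
      sig γ (i :: List.ofFn f) s b • wordOp A (i :: List.ofFn f) := by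
  rw [sigLevel, ← (Fin.consEquiv fun _ : Fin (n + 1) => Fin d).sum_comp, Fintype.sum_prod_type]
  simp [Fin.consEquiv, List.ofFn_succ]

theorem sigLevel_succ_self (A : EuclideanSpace ℝ (Fin d) → (F →L[ℝ] F))
    (γ : ℝ → EuclideanSpace ℝ (Fin d)) (b : ℝ) (n : ℕ) : sigLevel A γ b (n + 1) b = 0 := by
  simp [sigLevel_succ, sig]

theorem map_eq_sum_smul_single (A : EuclideanSpace ℝ (Fin d) →ₗ[ℝ] (F →L[ℝ] F))
    (v : EuclideanSpace ℝ (Fin d)) :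
    A v = ∑ i, v i • A (EuclideanSpace.single i 1) := by
  conv_lhs => rw [← (EuclideanSpace.basisFun (Fin d) ℝ).sum_repr v]
  simp

theorem hasDerivAt_sigLevel_succ (A : EuclideanSpace ℝ (Fin d) →ₗ[ℝ] (F →L[ℝ] F))
    {γ : ℝ → EuclideanSpace ℝ (Fin d)} (hγ : Continuous (deriv γ)) (b : ℝ) (n : ℕ) (s : ℝ) :
    HasDerivAt (sigLevel (fun e => A e) γ b (n + 1))
      (-(sigLevel (fun e => A e) γ b n s).comp (A (deriv γ s))) s := by
  have h : HasDerivAt (fun s => ∑ i : Fin d, ∑ f : Fin n → Fin d,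
      sig γ (i :: List.ofFn f) s b • wordOp (fun e => A e) (i :: List.ofFn f))
      (∑ i : Fin d, ∑ f : Fin n → Fin d,
        (-(deriv γ s i * sig γ (List.ofFn f) s b)) • wordOp (fun e => A e) (i :: List.ofFn f)) s :=
    HasDerivAt.fun_sum fun i _ => HasDerivAt.fun_sum fun f _ =>
      (hasDerivAt_sig_cons hγ i (List.ofFn f) s b).smul_const
        (wordOp (fun e => A e) (i :: List.ofFn f))
  rw [show sigLevel (fun e => A e) γ b (n + 1) = _ from funext (sigLevel_succ _ γ b n)]
  convert h using 1
  rw [map_eq_sum_smul_single]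
  ext x
  simp only [sigLevel, wordOp, neg_smul, Finset.sum_neg_distrib, _root_.neg_apply,
    ContinuousLinearMap.comp_apply, _root_.sum_apply, _root_.smul_apply,
    map_sum, map_smul, mul_smul, Finset.smul_sum]

theorem continuous_sigLevel (A : EuclideanSpace ℝ (Fin d) → (F →L[ℝ] F))
    {γ : ℝ → EuclideanSpace ℝ (Fin d)} (hγ : Continuous (deriv γ)) (b : ℝ) (n : ℕ) :
    Continuous (sigLevel A γ b n) :=
  continuous_finsetSum _ fun f _ => (continuous_sig hγ (List.ofFn f) b).smul continuous_const

theorem norm_sigLevel_le [CompleteSpace F] (A : EuclideanSpace ℝ (Fin d) →ₗ[ℝ] (F →L[ℝ] F))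
    {γ : ℝ → EuclideanSpace ℝ (Fin d)} (hγ : Continuous (deriv γ)) {a b K : ℝ}
    (hK : ∀ u ∈ Icc a b, ‖A (deriv γ u)‖ ≤ K) (n : ℕ) {s : ℝ} (hs : s ∈ Icc a b) :
    ‖sigLevel (fun e => A e) γ b n s‖ ≤ (K * (b - s)) ^ n / n.factorial := by
  induction n generalizing s with
  | zero => simpa [sigLevel_zero] using ContinuousLinearMap.norm_id_le
  | succ n ih =>
    have hA : Continuous A := A.continuous_of_finiteDimensional
    have hK0 : 0 ≤ K := (norm_nonneg _).trans (hK s hs)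
    have hT := continuous_sigLevel (fun e => A e) hγ b n
    have hc : Continuous fun u => -(sigLevel (fun e => A e) γ b n u).comp (A (deriv γ u)) :=
      (hT.clm_comp (hA.comp hγ)).neg
    have hint := integral_eq_sub_of_hasDerivAt
      (fun u _ => hasDerivAt_sigLevel_succ A hγ b n u) (hc.intervalIntegrable s b)
    have hd : ∀ u, HasDerivAt (fun u : ℝ => -((K * (b - u)) ^ (n + 1) / (n + 1).factorial))
        ((K * (b - u)) ^ n / n.factorial * K) u := by
      intro u
      have h := (((((hasDerivAt_id u).const_sub b).const_mul K).pow (n + 1)).div_const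
        ((n + 1).factorial : ℝ)).neg
      refine h.congr_deriv ?_
      have : (n.factorial : ℝ) ≠ 0 := by positivity
      have : (n : ℝ) + 1 ≠ 0 := by positivity
      simp only [Nat.factorial_succ, id]
      push_cast
      field_simp
    have hc' : Continuous fun u : ℝ => (K * (b - u)) ^ n / n.factorial * K := by fun_prop
    have hint' := integral_eq_sub_of_hasDerivAt (fun u _ => hd u) (hc'.intervalIntegrable s b)
    rw [sigLevel_succ_self, zero_sub] at hint
    rw [← norm_neg, ← hint]
    refine (intervalIntegral.norm_integral_le_of_norm_le hs.2 (.of_forall fun u hu => ?_)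
      (hc'.intervalIntegrable s b)).trans_eq (hint'.trans (by simp))
    have hu' : u ∈ Icc a b := ⟨hs.1.trans hu.1.le, hu.2⟩
    rw [norm_neg]
    exact (ContinuousLinearMap.opNorm_comp_le _ _).trans
      (mul_le_mul (ih hu') (hK u hu') (norm_nonneg _) ((norm_nonneg _).trans (ih hu')))

theorem hasDerivAt_sum_sigLevel_apply (A : EuclideanSpace ℝ (Fin d) →ₗ[ℝ] (F →L[ℝ] F))
    {γ : ℝ → EuclideanSpace ℝ (Fin d)} (hγ : Continuous (deriv γ)) (b : ℝ) {y : ℝ → F} {s : ℝ}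
    (hy : HasDerivAt y (A (deriv γ s) (y s)) s) (N : ℕ) :
    HasDerivAt (fun s => ∑ n ∈ Finset.range (N + 1), sigLevel (fun e => A e) γ b n s (y s))
      (sigLevel (fun e => A e) γ b N s (A (deriv γ s) (y s))) s := by
  induction N with
  | zero => simpa [sigLevel_zero] using hy
  | succ N ih =>
    simp only [Finset.sum_range_succ _ (N + 1)]
    refine (ih.add ((hasDerivAt_sigLevel_succ A hγ b N s).clm_apply hy)).congr_deriv ?_
    simp

end sigLevel

/-- The solution of the linear controlled differential equation
`dy = A(dγ) y` is given by the absolutely convergent series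
`y(b) = Σₙ Σ_{|w| = n} S^w_{a,b}(γ) • (A(e_{iₙ}) ∘ ⋯ ∘ A(e_{i₁}))(y(a))`. -/
theorem linear_CDE_signature_series {d : ℕ} {F : Type*}
    [NormedAddCommGroup F] [NormedSpace ℝ F] [CompleteSpace F]
    (A : EuclideanSpace ℝ (Fin d) →ₗ[ℝ] (F →L[ℝ] F))
    (γ : ℝ → EuclideanSpace ℝ (Fin d)) (a b : ℝ) (hab : a ≤ b)
    (hγ : ContDiff ℝ 1 γ) (y : ℝ → F)
    (hy : ∀ t ∈ Set.Icc a b, HasDerivAt y (A (deriv γ t) (y t)) t) :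
    HasSum (fun n : ℕ => ∑ f : Fin n → Fin d,
        sig γ (List.ofFn f) a b • wordOp (fun e => A e) (List.ofFn f) (y a)) (y b) ∧
      Summable (fun n : ℕ => ‖∑ f : Fin n → Fin d,
        sig γ (List.ofFn f) a b • wordOp (fun e => A e) (List.ofFn f) (y a)‖) := by
  have hγ' : Continuous (deriv γ) := hγ.continuous_deriv le_rfl
  have hA : Continuous A := A.continuous_of_finiteDimensional
  obtain ⟨K, hK⟩ := isCompact_Icc.exists_bound_of_continuousOn (s := Icc a b)
    (hA.comp hγ').continuousOn
  have hyc : ContinuousOn y (Icc a b) := fun t ht => (hy t ht).continuousAt.continuousWithinAt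
  obtain ⟨M, hM⟩ := isCompact_Icc.exists_bound_of_continuousOn hyc
  have ha : a ∈ Icc a b := left_mem_Icc.2 hab
  have hK0 : 0 ≤ K := (norm_nonneg _).trans (hK a ha)
  have hM0 : 0 ≤ M := (norm_nonneg _).trans (hM a ha)
  have hterm : ∀ n : ℕ, (∑ f : Fin n → Fin d,
      sig γ (List.ofFn f) a b • wordOp (fun e => A e) (List.ofFn f) (y a)) =
      sigLevel (fun e => A e) γ b n a (y a) := fun n => by
    simp [sigLevel]
  simp only [hterm]
  have hexp := Real.summable_pow_div_factorial (K * (b - a))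
  have hsum : Summable fun n => ‖sigLevel (fun e => A e) γ b n a (y a)‖ :=
    (hexp.mul_right ‖y a‖).of_nonneg_of_le (fun _ => norm_nonneg _) fun n =>
      (sigLevel (fun e => A e) γ b n a).le_of_opNorm_le (norm_sigLevel_le A hγ' hK n ha) (y a)
  refine ⟨?_, hsum⟩
  rw [hsum.of_norm.hasSum_iff_tendsto_nat, ← tendsto_add_atTop_iff_nat 1,
    tendsto_iff_norm_sub_tendsto_zero]
  have hlim : Tendsto (fun N : ℕ => (K * (b - a)) ^ N / N.factorial * (K * M) * (b - a))
      atTop (nhds 0) := by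
    simpa using (hexp.tendsto_atTop_zero.mul_const (K * M)).mul_const (b - a)
  refine squeeze_zero (fun _ => norm_nonneg _) (fun N => ?_) hlim
  have hmv := norm_image_sub_le_of_norm_deriv_le_segment'
    (f := fun s => ∑ n ∈ Finset.range (N + 1), sigLevel (fun e => A e) γ b n s (y s))
    (C := (K * (b - a)) ^ N / N.factorial * (K * M))
    (fun s hs => (hasDerivAt_sum_sigLevel_apply A hγ' b (hy s hs) N).hasDerivWithinAt)
    (fun s hs => ?_) b (right_mem_Icc.2 hab)
  · have hb : ∑ n ∈ Finset.range (N + 1), sigLevel (fun e => A e) γ b n b (y b) = y b := by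
      simp [Finset.sum_range_succ', sigLevel_succ_self, sigLevel_zero]
    rw [norm_sub_rev]
    simpa only [hb] using hmv
  · have hs' := Ico_subset_Icc_self hs
    have hle : (K * (b - s)) ^ N / N.factorial ≤ (K * (b - a)) ^ N / N.factorial := by
      have h0 : 0 ≤ K * (b - s) := mul_nonneg hK0 (sub_nonneg.2 hs'.2)
      gcongr
      exact hs'.1
    have hAy : ‖A (deriv γ s) (y s)‖ ≤ K * M :=
      (A (deriv γ s)).le_of_opNorm_le_of_le (hK s hs') (hM s hs')
    exact (sigLevel (fun e => A e) γ b N s).le_of_opNorm_le_of_le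
      ((norm_sigLevel_le A hγ' hK N hs').trans hle) hAy
end

section
/- (Chen's identity / splitting.) Let γ : [a,b] → ℝ^d be a C¹ path and let a ≤ t ≤ b. Then for every word w = (w₁,…,wₙ) over {1,…,d}, S^w_{a,b}(γ) = Σ_{k=0}^{n} S^{(w₁,…,w_k)}_{a,t}(γ) · S^{(w_{k+1},…,wₙ)}_{t,b}(γ), i.e. the signature of the concatenation of the two segments is the tensor product of the signatures of the segments. -/
open MeasureTheory intervalIntegral Set Filter

theorem continuous_deriv_apply {d : ℕ} {γ : ℝ → EuclideanSpace ℝ (Fin d)}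
    (hγ : ContDiff ℝ 1 γ) (i : Fin d) : Continuous fun u => deriv γ u i := by
  have h : Continuous (deriv γ) := hγ.continuous_deriv le_rfl
  fun_prop

/-- Signature coefficients of a `C¹` path depend continuously on the initial time. -/
theorem continuous_sig_left {d : ℕ} {γ : ℝ → EuclideanSpace ℝ (Fin d)}
    (hγ : ContDiff ℝ 1 γ) (w : List (Fin d)) (t : ℝ) : Continuous fun s => sig γ w s t := by
  induction w with
  | nil => simpa only [sig] using continuous_const
  | cons i w ih =>
    have hc : Continuous fun u => deriv γ u i * sig γ w u t :=
      (continuous_deriv_apply hγ i).mul ih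
    simp only [sig, integral_symm t]
    exact (continuous_primitive (fun x y => hc.intervalIntegrable x y) t).neg

/-- Chen's identity: splitting the interval `[a,b]` at `t`, the signature of the
concatenation is the tensor product of the signatures of the two segments:
`S^w_{a,b} = Σ_{k=0}^{n} S^{(w₁,…,w_k)}_{a,t} · S^{(w_{k+1},…,wₙ)}_{t,b}`. -/
theorem chen_identity {d : ℕ}
    (γ : ℝ → EuclideanSpace ℝ (Fin d)) (a b t : ℝ) (hat : a ≤ t) (htb : t ≤ b)
    (hγ : ContDiff ℝ 1 γ) (w : List (Fin d)) :
    sig γ w a b =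
      ∑ k ∈ Finset.range (w.length + 1), sig γ (w.take k) a t * sig γ (w.drop k) t b := by
  clear hat htb
  induction w generalizing a with
  | nil => simp [sig]
  | cons i w ih =>
    have hc (v : List (Fin d)) (r : ℝ) : Continuous fun u => deriv γ u i * sig γ v u r :=
      (continuous_deriv_apply hγ i).mul (continuous_sig_left hγ v r)
    have hsplit : sig γ (i :: w) a b =
        (∫ u in a..t, deriv γ u i * sig γ w u b) + sig γ (i :: w) t b :=
      (integral_add_adjacent_intervals ((hc w b).intervalIntegrable a t)
        ((hc w b).intervalIntegrable t b)).symm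
    rw [hsplit, List.length_cons, Finset.sum_range_succ']
    simp only [List.take_succ_cons, List.drop_succ_cons, List.take_zero, List.drop_zero]
    congr 1
    · simp only [ih, Finset.mul_sum, ← mul_assoc]
      rw [intervalIntegral.integral_finsetSum]
      · simp only [intervalIntegral.integral_mul_const, sig]
      · exact fun k _ => ((hc (w.take k) t).mul continuous_const).intervalIntegrable a t
    · simp [sig]
end

section
/- (Reversal gives the inverse tensor.) Let γ : [a,b] → ℝ^d be a C¹ path and let ←γ : [a,b] → ℝ^d be the reversed path ←γ(t) = γ(a + b − t). Then for every nonempty word w = (w₁,…,wₙ) over {1,…,d}, Σ_{k=0}^{n} S^{(w₁,…,w_k)}_{a,b}(γ) · S^{(w_{k+1},…,wₙ)}_{a,b}(←γ) = 0; equivalently, the signature tensor of ←γ is the inverse of the signature tensor of γ in the algebra of tensor series under the concatenation (tensor) product. -/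
open MeasureTheory intervalIntegral Set Filter

/-- Chen's identity, for arbitrary (not necessarily ordered) times. -/
theorem sig_eq_sum_take_mul_drop {d : ℕ} {γ : ℝ → EuclideanSpace ℝ (Fin d)}
    (hγ : ContDiff ℝ 1 γ) (w : List (Fin d)) (s u t : ℝ) :
    sig γ w s t =
      ∑ k ∈ Finset.range (w.length + 1), sig γ (w.take k) s u * sig γ (w.drop k) u t := by
  induction w generalizing s with
  | nil => simp [sig]
  | cons i w ih =>
    have hc (v : List (Fin d)) (r : ℝ) : Continuous fun x => deriv γ x i * sig γ v x r :=
      (continuous_deriv_apply hγ i).mul (continuous_sig_left hγ v r)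
    rw [List.length_cons, Finset.sum_range_succ']
    simp only [List.take_succ_cons, List.drop_succ_cons, List.take_zero, List.drop_zero]
    simp only [sig, one_mul]
    rw [← integral_add_adjacent_intervals ((hc w t).intervalIntegrable s u)
      ((hc w t).intervalIntegrable u t)]
    congr 1
    simp_rw [← intervalIntegral.integral_mul_const]
    rw [← intervalIntegral.integral_finsetSum
      fun k _ => ((hc (w.take k) u).intervalIntegrable s u).mul_const _]
    refine intervalIntegral.integral_congr fun x _ => ?_
    simp only [ih x, Finset.mul_sum, mul_assoc]

theorem sig_comp_const_sub {d : ℕ} (γ : ℝ → EuclideanSpace ℝ (Fin d)) (c : ℝ)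
    (w : List (Fin d)) (s t : ℝ) :
    sig (fun x => γ (c - x)) w s t = sig γ w (c - s) (c - t) := by
  induction w generalizing s with
  | nil => rfl
  | cons i w ih =>
    simp only [sig, ih, deriv_comp_const_sub, PiLp.neg_apply, neg_mul,
      intervalIntegral.integral_neg]
    rw [intervalIntegral.integral_comp_sub_left
      (fun x => deriv γ x i * sig γ w x (c - t)) c, integral_symm, neg_neg]

theorem sig_self {d : ℕ} (γ : ℝ → EuclideanSpace ℝ (Fin d)) {w : List (Fin d)}
    (hw : w ≠ []) (t : ℝ) : sig γ w t t = 0 := by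
  cases w with
  | nil => exact absurd rfl hw
  | cons i w => simp [sig]

/-- Reversal gives the inverse tensor: the signature of the reversed path
`←γ(t) = γ(a + b − t)` is the inverse, under the concatenation (tensor)
product, of the signature of `γ`: for every nonempty word `w`,
`Σ_{k=0}^{n} S^{(w₁,…,w_k)}_{a,b}(γ) · S^{(w_{k+1},…,wₙ)}_{a,b}(←γ) = 0`. -/
theorem signature_reverse_inverse {d : ℕ}
    (γ : ℝ → EuclideanSpace ℝ (Fin d)) (a b : ℝ) (hab : a ≤ b)
    (hγ : ContDiff ℝ 1 γ) (w : List (Fin d)) (hw : w ≠ []) :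
    ∑ k ∈ Finset.range (w.length + 1),
      sig γ (w.take k) a b * sig (fun t => γ (a + b - t)) (w.drop k) a b = 0 := by
  simp only [sig_comp_const_sub, add_sub_cancel_left, add_sub_cancel_right]
  rw [← sig_eq_sum_take_mul_drop hγ, sig_self γ hw]
end

section
/- The second-level iterated integral is not continuous (and in fact does not have closed graph) for the uniform topology: there exists a sequence (γ_k) of C¹ paths γ_k : [0,1] → ℝ² with γ_k(0) = γ_k(1) = 0 and sup_{t∈[0,1]} ‖γ_k(t)‖ → 0 as k → ∞, such that for every k the second-level signature coefficient satisfies S^{(1,2)}_{0,1}(γ_k) = 1. In particular, γ_k converges uniformly to the constant path (whose coefficient S^{(1,2)} is 0) while S^{(1,2)}_{0,1}(γ_k) does not converge to 0. -/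
open MeasureTheory intervalIntegral Set Filter

open Real in
/-- The loop of radius `a` based at `0` that runs `n` times around a circle on `[0,1]`. -/
noncomputable def circleLoop (a : ℝ) (n : ℕ) (t : ℝ) : EuclideanSpace ℝ (Fin 2) :=
  !₂[a * (cos (2 * π * n * t) - 1), a * sin (2 * π * n * t)]

theorem contDiff_circleLoop (a : ℝ) (n : ℕ) : ContDiff ℝ 1 (circleLoop a n) := by
  rw [contDiff_euclidean]
  intro i
  fin_cases i <;> simp only [circleLoop] <;> simp <;> fun_prop

theorem circleLoop_zero (a : ℝ) (n : ℕ) : circleLoop a n 0 = 0 := by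
  ext i
  fin_cases i <;> simp [circleLoop]

theorem circleLoop_one (a : ℝ) (n : ℕ) : circleLoop a n 1 = 0 := by
  have hc : Real.cos (2 * Real.pi * n) = 1 := by
    rw [mul_comm]; exact Real.cos_nat_mul_two_pi n
  have hs : Real.sin (2 * Real.pi * n) = 0 := by
    simpa [mul_comm, mul_left_comm, mul_assoc] using Real.sin_nat_mul_pi (2 * n)
  ext i
  fin_cases i <;> simp [circleLoop, hc, hs]

theorem norm_circleLoop_le {a : ℝ} (ha : 0 ≤ a) (n : ℕ) (t : ℝ) :
    ‖circleLoop a n t‖ ≤ 2 * a := by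
  rw [EuclideanSpace.norm_eq, Real.sqrt_le_left (by positivity)]
  simp only [circleLoop, Fin.sum_univ_two, Real.norm_eq_abs, sq_abs]
  simp only [Matrix.cons_val_zero, Matrix.cons_val_one]
  have h := Real.sin_sq_add_cos_sq (2 * Real.pi * n * t)
  have hc := Real.neg_one_le_cos (2 * Real.pi * n * t)
  nlinarith [mul_nonneg (sq_nonneg a) (by linarith : 0 ≤ Real.cos (2 * Real.pi * n * t) + 1)]

theorem hasDerivAt_euclidean_apply {d : ℕ} {γ : ℝ → EuclideanSpace ℝ (Fin d)}
    {u : ℝ} (hγ : DifferentiableAt ℝ γ u) (i : Fin d) :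
    HasDerivAt (fun v => γ v i) (deriv γ u i) u :=
  (EuclideanSpace.proj (𝕜 := ℝ) i).hasFDerivAt.comp_hasDerivAt u hγ.hasDerivAt

/-- By the fundamental theorem of calculus, a second-level signature coefficient of a `C¹` path
is a single integral. -/
theorem sig_pair {d : ℕ} {γ : ℝ → EuclideanSpace ℝ (Fin d)} (hγ : ContDiff ℝ 1 γ)
    (i j : Fin d) (s t : ℝ) :
    sig γ [i, j] s t = ∫ u in s..t, deriv γ u i * (γ t j - γ u j) := by
  have hd : Continuous fun v => deriv γ v j :=
    (EuclideanSpace.proj (𝕜 := ℝ) j).continuous.comp (hγ.continuous_deriv le_rfl)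
  simp only [sig, mul_one]
  refine integral_congr fun u _ => ?_
  rw [integral_eq_sub_of_hasDerivAt
    (fun v _ => hasDerivAt_euclidean_apply (hγ.differentiable one_ne_zero v) j)
    (hd.intervalIntegrable _ _)]

theorem deriv_circleLoop_apply_zero (a : ℝ) (n : ℕ) (u : ℝ) :
    deriv (circleLoop a n) u 0
      = -(a * (2 * Real.pi * n)) * Real.sin (2 * Real.pi * n * u) := by
  refine (hasDerivAt_euclidean_apply
    ((contDiff_circleLoop a n).differentiable one_ne_zero u) 0).unique ?_
  have h := ((((hasDerivAt_id u).const_mul (2 * Real.pi * n)).cos).sub_const 1).const_mul a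
  exact h.congr_deriv (by simp only [id]; ring)

theorem sig_circleLoop (a : ℝ) {n : ℕ} (hn : n ≠ 0) :
    sig (circleLoop a n) [0, 1] 0 1 = a ^ 2 * (Real.pi * n) := by
  have hn' : (2 * Real.pi * n : ℝ) ≠ 0 := by positivity
  have hs : Real.sin (2 * Real.pi * n) = 0 := by
    simpa [mul_comm, mul_left_comm, mul_assoc] using Real.sin_nat_mul_pi (2 * n)
  have hint (u : ℝ) : deriv (circleLoop a n) u 0 * (circleLoop a n 1 1 - circleLoop a n u 1)
      = a ^ 2 * (2 * Real.pi * n) * Real.sin (2 * Real.pi * n * u) ^ 2 := by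
    rw [deriv_circleLoop_apply_zero, circleLoop_one]
    simp only [circleLoop, PiLp.zero_apply, PiLp.toLp_apply, Matrix.cons_val_one,
      Matrix.cons_val_zero]
    ring
  simp only [sig_pair (contDiff_circleLoop a n), hint, intervalIntegral.integral_const_mul]
  rw [integral_comp_mul_left (fun x => Real.sin x ^ 2) hn', integral_sin_sq]
  simp only [mul_zero, mul_one, Real.sin_zero, zero_mul, hs, smul_eq_mul]
  field_simp
  ring

/-- The second-level iterated integral fails the closed graph property in the
uniform topology: there is a sequence of C¹ loops `γ_k : [0,1] → ℝ²` based at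
`0` converging uniformly to `0`, whose second-level signature coefficient
`S^{(1,2)}_{0,1}(γ_k)` is constantly `1` (whereas the constant path has
coefficient `0`). -/
theorem second_level_not_uniformly_continuous :
    ∃ γ : ℕ → ℝ → EuclideanSpace ℝ (Fin 2),
      (∀ k, ContDiff ℝ 1 (γ k)) ∧
      (∀ k, γ k 0 = 0 ∧ γ k 1 = 0) ∧
      Filter.Tendsto (fun k => ⨆ t : Set.Icc (0 : ℝ) 1, ‖γ k t‖)
        Filter.atTop (nhds 0) ∧
      ∀ k, sig (γ k) [(0 : Fin 2), (1 : Fin 2)] 0 1 = 1 := by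
  let a (k : ℕ) : ℝ := √(Real.pi * (k + 1 : ℕ))⁻¹
  refine ⟨fun k => circleLoop (a k) (k + 1), fun k => contDiff_circleLoop _ _,
    fun k => ⟨circleLoop_zero _ _, circleLoop_one _ _⟩, ?_, fun k => ?_⟩
  · have ha : Tendsto (fun k => 2 * a k) atTop (nhds 0) := by
      have hN : Tendsto (fun k : ℕ => Real.pi * ((k + 1 : ℕ) : ℝ)) atTop atTop :=
        (tendsto_natCast_atTop_atTop.comp (tendsto_add_atTop_nat 1)).const_mul_atTop Real.pi_pos
      have h := hN.inv_tendsto_atTop.sqrt.const_mul 2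
      rwa [Real.sqrt_zero, mul_zero] at h
    exact squeeze_zero (fun k => Real.iSup_nonneg fun _ => norm_nonneg _)
      (fun k => ciSup_le fun t => norm_circleLoop_le (Real.sqrt_nonneg _) _ _) ha
  · rw [sig_circleLoop _ k.succ_ne_zero, Real.sq_sqrt (by positivity)]
    exact inv_mul_cancel₀ (by positivity)
end

section
/- (Joint continuity of the response of a linear controlled differential equation.) Let F be a real Banach space. For k ∈ ℕ let A_k, A : ℝ^d → (F →L F) be continuous linear maps into the bounded operators on F, let γ_k, γ : [a,b] → ℝ^d be C¹ paths, and let y_k, y : [a,b] → F be differentiable with y_k'(t) = A_k(γ_k'(t))(y_k(t)) and y'(t) = A(γ'(t))(y(t)). If ‖A_k − A‖ → 0 in operator norm, ∫_a^b ‖γ_k'(u) − γ'(u)‖ du → 0, and y_k(a) → y(a) in F, then y_k(b) → y(b) in F. -/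
open MeasureTheory intervalIntegral Set Filter

/-- Grönwall's inequality with continuous time-dependent coefficients: if
`‖f'‖ ≤ κ ‖f‖ + β` on `[a, b)`, then `‖f‖` grows at most by the factor `exp (∫ κ)`
after adding `∫ β` to the initial value. -/
theorem norm_le_add_integral_mul_exp_integral {E : Type*} [NormedAddCommGroup E]
    [NormedSpace ℝ E] {f f' : ℝ → E} {κ β : ℝ → ℝ} {a b : ℝ} (hab : a ≤ b)
    (hf : ContinuousOn f (Icc a b))
    (hf' : ∀ t ∈ Ico a b, HasDerivWithinAt f (f' t) (Ici t) t)
    (hκ : Continuous κ) (hβ : Continuous β)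
    (hκ0 : ∀ t, 0 ≤ κ t) (hβ0 : ∀ t, 0 ≤ β t)
    (bound : ∀ t ∈ Ico a b, ‖f' t‖ ≤ κ t * ‖f t‖ + β t) :
    ‖f b‖ ≤ (‖f a‖ + ∫ u in a..b, β u) * Real.exp (∫ u in a..b, κ u) := by
  have key : ∀ ε : ℝ, 0 < ε →
      ‖f b‖ ≤ (‖f a‖ + (∫ u in a..b, β u) + ε * (b - a)) * Real.exp (∫ u in a..b, κ u) := by
    intro ε hε
    have hB : ∀ t, HasDerivAt
        (fun t => (‖f a‖ + (∫ u in a..t, β u) + ε * (t - a)) * Real.exp (∫ u in a..t, κ u))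
        ((β t + ε) * Real.exp (∫ u in a..t, κ u) +
          (‖f a‖ + (∫ u in a..t, β u) + ε * (t - a)) *
            (Real.exp (∫ u in a..t, κ u) * κ t)) t := by
      intro t
      have hb := hβ.integral_hasStrictDerivAt a t |>.hasDerivAt
      have hk := hκ.integral_hasStrictDerivAt a t |>.hasDerivAt
      have hl : HasDerivAt (fun t => ε * (t - a)) ε t := by
        simpa using ((hasDerivAt_id t).sub_const a).const_mul ε
      exact ((hb.const_add ‖f a‖).add hl).mul hk.exp
    refine image_norm_le_of_norm_deriv_right_lt_deriv_boundary' hf hf' (by simp)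
      (fun t _ => (hB t).continuousAt.continuousWithinAt)
      (fun t _ => (hB t).hasDerivWithinAt) (fun t ht heq => ?_) (right_mem_Icc.2 hab)
    have hbt := bound t ht
    rw [heq] at hbt
    have hexp : 1 ≤ Real.exp (∫ u in a..t, κ u) :=
      Real.one_le_exp (integral_nonneg ht.1 fun u _ => hκ0 u)
    nlinarith [mul_le_mul_of_nonneg_left hexp (add_nonneg (hβ0 t) hε.le)]
  have hlim : Tendsto (fun ε : ℝ =>
      (‖f a‖ + (∫ u in a..b, β u) + ε * (b - a)) * Real.exp (∫ u in a..b, κ u))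
      (nhdsWithin 0 (Ioi 0))
      (nhds ((‖f a‖ + ∫ u in a..b, β u) * Real.exp (∫ u in a..b, κ u))) := by
    refine tendsto_nhdsWithin_of_tendsto_nhds (Continuous.tendsto' (by fun_prop) _ _ (by simp))
  exact ge_of_tendsto hlim (eventually_mem_nhdsWithin.mono key)

/-- Quantitative stability of linear controlled differential equations in the dynamics, the
control (in 1-variation) and the initial condition. -/
theorem norm_linear_CDE_sub_le {V F : Type*} [NormedAddCommGroup V] [NormedSpace ℝ V]
    [NormedAddCommGroup F] [NormedSpace ℝ F] {a b M : ℝ} (hab : a ≤ b)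
    {A A' : V →L[ℝ] F →L[ℝ] F} {x x' : ℝ → V} (hx : Continuous x) (hx' : Continuous x')
    {y y' : ℝ → F} (hy : ∀ t ∈ Icc a b, HasDerivAt y (A (x t) (y t)) t)
    (hy' : ∀ t ∈ Icc a b, HasDerivAt y' (A' (x' t) (y' t)) t)
    (hM : ∀ t ∈ Icc a b, ‖y' t‖ ≤ M) :
    ‖y b - y' b‖ ≤
      (‖y a - y' a‖ + M * (‖A - A'‖ * (∫ u in a..b, ‖x' u‖) +
        ‖A‖ * ∫ u in a..b, ‖x u - x' u‖)) *
        Real.exp (‖A‖ * ((∫ u in a..b, ‖x u - x' u‖) + ∫ u in a..b, ‖x' u‖)) := by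
  have hM0 : 0 ≤ M := (norm_nonneg _).trans (hM a (left_mem_Icc.2 hab))
  have hdiff : Continuous fun u => ‖x u - x' u‖ := (hx.sub hx').norm
  have hderiv : ∀ t ∈ Icc a b, HasDerivAt (fun t => y t - y' t)
      (A (x t) (y t) - A' (x' t) (y' t)) t :=
    fun t ht => (hy t ht).sub (hy' t ht)
  have hgron := norm_le_add_integral_mul_exp_integral
    (κ := fun t => ‖A‖ * (‖x t - x' t‖ + ‖x' t‖))
    (β := fun t => M * (‖A - A'‖ * ‖x' t‖ +
      ‖A‖ * ‖x t - x' t‖)) hab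
    (fun t ht => (hderiv t ht).continuousAt.continuousWithinAt)
    (fun t ht => (hderiv t (Ico_subset_Icc_self ht)).hasDerivWithinAt)
    (by fun_prop) (by fun_prop) (fun t => by positivity) (fun t => by positivity)
    (fun t ht => ?_)
  · rwa [intervalIntegral.integral_const_mul, intervalIntegral.integral_const_mul,
      intervalIntegral.integral_add (hdiff.intervalIntegrable _ _)
        (hx'.norm.intervalIntegrable _ _),
      intervalIntegral.integral_add ((hx'.norm.const_mul _).intervalIntegrable _ _)
        ((hdiff.const_mul _).intervalIntegrable _ _),
      intervalIntegral.integral_const_mul, intervalIntegral.integral_const_mul] at hgron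
  · have hsplit : A (x t) (y t) - A' (x' t) (y' t) =
        A (x t) (y t - y' t) + ((A - A') (x' t) (y' t) +
          A (x t - x' t) (y' t)) := by
      simp only [map_sub, sub_apply]
      abel
    have hMt := hM t (Ico_subset_Icc_self ht)
    have hγt : ‖x t‖ ≤ ‖x t - x' t‖ + ‖x' t‖ := by
      simpa using norm_add_le (x t - x' t) (x' t)
    rw [hsplit]
    calc _ ≤ ‖A (x t) (y t - y' t)‖ +
          (‖(A - A') (x' t) (y' t)‖ +
            ‖A (x t - x' t) (y' t)‖) :=
          (norm_add_le _ _).trans (by gcongr; exact norm_add_le _ _)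
      _ ≤ ‖A‖ * ‖x t‖ * ‖y t - y' t‖ +
          (‖A - A'‖ * ‖x' t‖ * ‖y' t‖ +
            ‖A‖ * ‖x t - x' t‖ * ‖y' t‖) := by
          gcongr <;> exact ContinuousLinearMap.le_opNorm₂ _ _ _
      _ ≤ ‖A‖ * (‖x t - x' t‖ + ‖x' t‖) * ‖y t - y' t‖ +
          (‖A - A'‖ * ‖x' t‖ * M +
            ‖A‖ * ‖x t - x' t‖ * M) := by gcongr
      _ = _ := by ring

/-- Joint continuity of the response of a linear controlled differential
equation: if the dynamics `A_k → A` in operator norm, the controls `γ_k → γ` in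
1-variation, and the initial conditions `y_k(a) → y(a)`, then the responses
converge: `y_k(b) → y(b)`. -/
theorem linear_CDE_jointly_continuous {d : ℕ} {F : Type*}
    [NormedAddCommGroup F] [NormedSpace ℝ F] [CompleteSpace F]
    (a b : ℝ) (hab : a ≤ b)
    (A : ℕ → (EuclideanSpace ℝ (Fin d) →L[ℝ] (F →L[ℝ] F)))
    (Alim : EuclideanSpace ℝ (Fin d) →L[ℝ] (F →L[ℝ] F))
    (γ : ℕ → ℝ → EuclideanSpace ℝ (Fin d)) (γlim : ℝ → EuclideanSpace ℝ (Fin d))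
    (hγ : ∀ k, ContDiff ℝ 1 (γ k)) (hγlim : ContDiff ℝ 1 γlim)
    (y : ℕ → ℝ → F) (ylim : ℝ → F)
    (hy : ∀ k, ∀ t ∈ Set.Icc a b, HasDerivAt (y k) (A k (deriv (γ k) t) (y k t)) t)
    (hylim : ∀ t ∈ Set.Icc a b, HasDerivAt ylim (Alim (deriv γlim t) (ylim t)) t)
    (hA : Filter.Tendsto (fun k => ‖A k - Alim‖) Filter.atTop (nhds 0))
    (hvar : Filter.Tendsto
      (fun k => ∫ u in a..b, ‖deriv (γ k) u - deriv γlim u‖)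
      Filter.atTop (nhds 0))
    (hy0 : Filter.Tendsto (fun k => y k a) Filter.atTop (nhds (ylim a))) :
    Filter.Tendsto (fun k => y k b) Filter.atTop (nhds (ylim b)) := by
  have hcont : Continuous (deriv γlim) := hγlim.continuous_deriv le_rfl
  obtain ⟨M, hM⟩ := isCompact_Icc.exists_bound_of_continuousOn
    (fun t ht => (hylim t ht).continuousAt.continuousWithinAt : ContinuousOn ylim (Icc a b))
  have hAn : Tendsto (fun k => ‖A k‖) atTop (nhds ‖Alim‖) :=
    tendsto_iff_norm_sub_tendsto_zero.2 <|
      squeeze_zero (fun _ => norm_nonneg _) (fun k => abs_norm_sub_norm_le (A k) Alim) hA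
  refine tendsto_iff_norm_sub_tendsto_zero.2 (squeeze_zero (fun _ => norm_nonneg _)
    (fun k => norm_linear_CDE_sub_le hab ((hγ k).continuous_deriv le_rfl) hcont (hy k) hylim hM) ?_)
  simpa using ((tendsto_iff_norm_sub_tendsto_zero.1 hy0).add
    (((hA.mul_const (∫ u in a..b, ‖deriv γlim u‖)).add (hAn.mul hvar)).const_mul M)).mul
    (hAn.mul (hvar.add_const (∫ u in a..b, ‖deriv γlim u‖))).rexp
end

section
/- (Fawcett's theorem.) Let d ≥ 1 and model tensor series over ℝ^d as functions x : Words(d) → ℝ on finite words over the alphabet {1,…,d}, equipped with the product topology. Call x grouplike if x(∅) = 1 and for all words u, v one has x(u)·x(v) = Σ_s x(w(s)), the sum over all shuffles w(s) of u and v (for each subset s ⊆ {1,…,|u|+|v|} with |s| = |u|, w(s) places the letters of u in order at the positions of s and the letters of v in order at the remaining positions). Let K be a compact subset of the set of grouplike elements and let μ, ν be Borel probability measures on K such that ∫ x(w) dμ(x) = ∫ x(w) dν(x) for every word w. Then μ = ν. In other words, the expected signature of a compactly supported law on signatures uniquely determines that law. -/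
open MeasureTheory Set Filter

/-- Given words `u, v` and a subset `s` of the positions `{0,…,m+n-1}` (where
`m = |u|`, `n = |v|`), the interleaved word placing the letters of `u` in order
at the positions of `s` and the letters of `v` in order at the remaining
positions. -/
def shuffleWord {α : Type*} (u v : List α) (s : Finset (Fin (u.length + v.length))) :
    List α :=
  (List.finRange (u.length + v.length)).filterMap fun p =>
    if p ∈ s then u[(s.filter (fun q => q < p)).card]?
    else v[((sᶜ : Finset (Fin (u.length + v.length))).filter (fun q => q < p)).card]?

/-- A tensor series over `ℝ^d`, modelled as a function on words, is grouplike
if its empty-word coordinate is `1` and it satisfies the shuffle relations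
`x(u)·x(v) = Σ_s x(w(s))`, the sum over all shuffles of `u` and `v`. -/
def IsGrouplike {d : ℕ} (x : List (Fin d) → ℝ) : Prop :=
  x [] = 1 ∧ ∀ u v : List (Fin d),
    x u * x v =
      ∑ s ∈ Finset.powersetCard u.length
          (Finset.univ : Finset (Fin (u.length + v.length))),
        x (shuffleWord u v s)

/-- The coordinate function `x ↦ x w` restricted to a set of tensor series. -/
def coordinateMap {d : ℕ} (K : Set (List (Fin d) → ℝ)) (w : List (Fin d)) : C(K, ℝ) :=
  ⟨fun x => x.1 w, (continuous_apply w).comp continuous_subtype_val⟩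

/-- On a set of grouplike elements, the linear span of the coordinate functions is a
subalgebra, by the shuffle relations. -/
def coordinateSubalgebra {d : ℕ} (K : Set (List (Fin d) → ℝ))
    (hKg : ∀ x ∈ K, IsGrouplike x) : Subalgebra ℝ C(K, ℝ) :=
  (Submodule.span ℝ (range (coordinateMap K))).toSubalgebra
    (Submodule.subset_span ⟨[], by ext x; exact (hKg x x.2).1⟩)
    (by
      intro f g hf hg
      have hfg := Submodule.mul_mem_mul hf hg
      rw [Submodule.span_mul_span] at hfg
      refine Submodule.span_le.2 ?_ hfg
      rintro _ ⟨_, ⟨u, rfl⟩, _, ⟨v, rfl⟩, rfl⟩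
      have huv : coordinateMap K u * coordinateMap K v =
          ∑ s ∈ Finset.powersetCard u.length
            (Finset.univ : Finset (Fin (u.length + v.length))),
            coordinateMap K (shuffleWord u v s) := by
        ext x
        simpa [coordinateMap] using (hKg x x.2).2 u v
      simp only [huv]
      exact Submodule.sum_mem _ fun s _ => Submodule.subset_span ⟨_, rfl⟩)

theorem coordinateSubalgebra_separatesPoints {d : ℕ} (K : Set (List (Fin d) → ℝ))
    (hKg : ∀ x ∈ K, IsGrouplike x) : (coordinateSubalgebra K hKg).SeparatesPoints := by
  intro x y hxy
  obtain ⟨w, hw⟩ := Function.ne_iff.1 (Subtype.coe_ne_coe.2 hxy)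
  exact ⟨_, ⟨coordinateMap K w, Submodule.subset_span ⟨w, rfl⟩, rfl⟩, hw⟩

/-- Integration against a finite measure on a compact space is continuous in the integrand. -/
theorem continuous_integral_continuousMap {X : Type*} [TopologicalSpace X] [CompactSpace X]
    [MeasurableSpace X] [BorelSpace X] (μ : Measure X) [IsFiniteMeasure μ] :
    Continuous fun f : C(X, ℝ) => ∫ x, f x ∂μ := by
  have h : (fun f : C(X, ℝ) => ∫ x, f x ∂μ) =
      fun f => ∫ x, ContinuousMap.toLp (E := ℝ) 1 μ ℝ f x ∂μ := by
    funext f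
    exact integral_congr_ae (ContinuousMap.coeFn_toLp μ f).symm
  rw [h]
  exact continuous_integral.comp (ContinuousMap.toLp (E := ℝ) 1 μ ℝ).continuous

/-- Finite measures on a compact set of grouplike elements are determined by the integrals of
the coordinate functions. -/
theorem measure_eq_of_integral_coordinateMap_eq {d : ℕ} (K : Set (List (Fin d) → ℝ))
    [CompactSpace K] (hKg : ∀ x ∈ K, IsGrouplike x) (μ ν : Measure K)
    [IsFiniteMeasure μ] [IsFiniteMeasure ν]
    (h : ∀ w, ∫ x, coordinateMap K w x ∂μ = ∫ x, coordinateMap K w x ∂ν) : μ = ν := by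
  have hint (ρ : Measure K) [IsFiniteMeasure ρ] (f : C(K, ℝ)) : Integrable f ρ :=
    f.continuous.integrable_of_hasCompactSupport (HasCompactSupport.of_compactSpace f)
  have hspan : ∀ f ∈ Submodule.span ℝ (range (coordinateMap K)),
      ∫ x, f x ∂μ = ∫ x, f x ∂ν := by
    intro f hf
    induction hf using Submodule.span_induction with
    | mem f hf => obtain ⟨w, rfl⟩ := hf; exact h w
    | zero => simp
    | add f g _ _ hf hg =>
      simp only [ContinuousMap.add_apply]
      rw [integral_add (hint μ f) (hint μ g), integral_add (hint ν f) (hint ν g), hf, hg]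
    | smul c f _ hf =>
      simp only [ContinuousMap.smul_apply]
      rw [integral_smul, integral_smul, hf]
  have hdense : Dense (coordinateSubalgebra K hKg : Set C(K, ℝ)) := fun f =>
    ContinuousMap.continuousMap_mem_subalgebra_closure_of_separatesPoints _
      (coordinateSubalgebra_separatesPoints K hKg) f
  have hall : (fun f : C(K, ℝ) => ∫ x, f x ∂μ) = fun f => ∫ x, f x ∂ν :=
    (continuous_integral_continuousMap μ).ext_on hdense
      (continuous_integral_continuousMap ν) hspan
  exact ext_of_forall_integral_eq_of_IsFiniteMeasure fun f => congrFun hall f.toContinuousMap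

/-- Fawcett's theorem: two Borel probability measures supported on a compact
set `K` of grouplike elements which have the same expected signature (the same
coordinate expectations `∫ x(w) dμ` for every word `w`) are equal. -/
theorem expected_signature_determines_law_compact {d : ℕ} (hd : 1 ≤ d)
    (K : Set (List (Fin d) → ℝ)) (hK : IsCompact K)
    (hKg : ∀ x ∈ K, IsGrouplike x)
    (μ ν : Measure (List (Fin d) → ℝ))
    [IsProbabilityMeasure μ] [IsProbabilityMeasure ν]
    (hμK : μ Kᶜ = 0) (hνK : ν Kᶜ = 0)
    (hexp : ∀ w : List (Fin d), ∫ x, x w ∂μ = ∫ x, x w ∂ν) :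
    μ = ν := by
  have : CompactSpace K := isCompact_iff_compactSpace.1 hK
  have hmeas : MeasurableSet K := hK.measurableSet
  have hmap (ρ : Measure (List (Fin d) → ℝ)) (hρ : ρ Kᶜ = 0) :
      (ρ.comap ((↑) : K → List (Fin d) → ℝ)).map (↑) = ρ := by
    rw [map_comap_subtype_coe hmeas, Measure.restrict_eq_self_of_ae_mem]
    exact mem_ae_iff.2 hρ
  have hcoord (ρ : Measure (List (Fin d) → ℝ)) (hρ : ρ Kᶜ = 0) (w : List (Fin d)) :
      ∫ x, coordinateMap K w x ∂(ρ.comap ((↑) : K → List (Fin d) → ℝ)) = ∫ x, x w ∂ρ := by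
    conv_rhs => rw [← hmap ρ hρ]
    exact ((MeasurableEmbedding.subtype_coe hmeas).integral_map fun x => x w).symm
  have hcomap := measure_eq_of_integral_coordinateMap_eq K hKg (μ.comap (↑)) (ν.comap (↑))
    fun w => by rw [hcoord μ hμK, hcoord ν hνK, hexp]
  rw [← hmap μ hμK, hcomap, hmap ν hνK]
end

section
/- (Chevyrev–Lyons radius-of-convergence criterion.) Let d ≥ 1 and model tensor series over ℝ^d as functions x : Words(d) → ℝ on finite words over {1,…,d}; call x grouplike if x(∅) = 1 and x satisfies the shuffle relations x(u)·x(v) = Σ_s x(w(s)) (sum over all shuffles of u and v) for all words u, v. For a grouplike x and n ≥ 0 let ‖x_n‖ = (Σ_{|w|=n} x(w)²)^{1/2} denote the Euclidean norm of the level-n component. Let μ be a Borel probability measure on the set G of grouplike elements such that for every r > 0, Σ_{n=0}^∞ rⁿ ∫_G ‖x_n‖ dμ(x) < ∞ (i.e. the power series Σ_n zⁿ E‖Sⁿ‖ has infinite radius of convergence). If ν is any Borel probability measure on G with ∫ |x(w)| dν(x) < ∞ and ∫ x(w) dν(x) = ∫ x(w) dμ(x) for every word w, then ν = μ. That is, the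 expected signature determines the law. -/
open MeasureTheory Set Filter

/-- The Euclidean norm of the level-`n` component of a tensor series `x`. -/
noncomputable def levelNorm {d : ℕ} (x : List (Fin d) → ℝ) (n : ℕ) : ℝ :=
  Real.sqrt (∑ f : Fin n → Fin d, (x (List.ofFn f)) ^ 2)

/-- The interleaving of `u` and `v` along a subset `s` of `{0,…,L-1}`, with `L` not tied to the
lengths of the words. -/
def interleave {α : Type*} (L : ℕ) (u v : List α) (s : Finset (Fin L)) : List α :=
  (List.finRange L).filterMap fun p =>
    if p ∈ s then u[(s.filter (fun q => q < p)).card]?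
    else v[((sᶜ : Finset (Fin L)).filter (fun q => q < p)).card]?

lemma card_filter_lt_insert_zero_map_succ {L : ℕ} (s : Finset (Fin L)) (p : Fin L) :
    ((insert 0 (s.map (Fin.succEmb L))).filter (fun q => q < p.succ)).card =
      (s.filter (fun q => q < p)).card + 1 := by
  have h : (insert 0 (s.map (Fin.succEmb L))).filter (fun q => q < p.succ) =
      insert 0 ((s.filter (fun q => q < p)).map (Fin.succEmb L)) := by
    ext q
    refine Fin.cases ?_ (fun q => ?_) q <;> simp
  rw [h, Finset.card_insert_of_notMem (by simp), Finset.card_map]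

lemma card_filter_lt_map_succ {L : ℕ} (s : Finset (Fin L)) (p : Fin L) :
    ((s.map (Fin.succEmb L)).filter (fun q => q < p.succ)).card =
      (s.filter (fun q => q < p)).card := by
  have h : (s.map (Fin.succEmb L)).filter (fun q => q < p.succ) =
      (s.filter (fun q => q < p)).map (Fin.succEmb L) := by
    ext q
    refine Fin.cases ?_ (fun q => ?_) q <;> simp
  rw [h, Finset.card_map]

lemma compl_insert_zero_map_succ {L : ℕ} (s : Finset (Fin L)) :
    (insert 0 (s.map (Fin.succEmb L)))ᶜ = sᶜ.map (Fin.succEmb L) := by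
  ext q
  refine Fin.cases ?_ (fun q => ?_) q <;> simp

lemma compl_map_succ {L : ℕ} (s : Finset (Fin L)) :
    (s.map (Fin.succEmb L))ᶜ = insert 0 (sᶜ.map (Fin.succEmb L)) := by
  ext q
  refine Fin.cases ?_ (fun q => ?_) q <;> simp

lemma interleave_cons_left {α : Type*} (L : ℕ) (a : α) (u v : List α) (s : Finset (Fin L)) :
    interleave (L + 1) (a :: u) v (insert 0 (s.map (Fin.succEmb L))) =
      a :: interleave L u v s := by
  unfold interleave
  rw [List.finRange_succ, List.filterMap_cons_some (b := a) (by simp), List.filterMap_map]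
  congr 1
  refine List.filterMap_congr fun p _ => ?_
  simp only [Function.comp, compl_insert_zero_map_succ, card_filter_lt_insert_zero_map_succ,
    card_filter_lt_map_succ]
  simp

lemma interleave_cons_right {α : Type*} (L : ℕ) (b : α) (u v : List α) (s : Finset (Fin L)) :
    interleave (L + 1) u (b :: v) (s.map (Fin.succEmb L)) = b :: interleave L u v s := by
  unfold interleave
  rw [List.finRange_succ, List.filterMap_cons_some (b := b) (by simp), List.filterMap_map]
  congr 1
  refine List.filterMap_congr fun p _ => ?_
  simp only [Function.comp, compl_map_succ, card_filter_lt_insert_zero_map_succ,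
    card_filter_lt_map_succ]
  simp

lemma sum_powersetCard_univ_succ {L : ℕ} (m : ℕ) (g : Finset (Fin (L + 1)) → ℝ) :
    ∑ s ∈ Finset.powersetCard (m + 1) Finset.univ, g s =
      (∑ s ∈ Finset.powersetCard m (Finset.univ : Finset (Fin L)),
        g (insert 0 (s.map (Fin.succEmb L)))) +
      ∑ s ∈ Finset.powersetCard (m + 1) (Finset.univ : Finset (Fin L)),
        g (s.map (Fin.succEmb L)) := by
  have h0 : (0 : Fin (L + 1)) ∉ (Finset.univ : Finset (Fin L)).map (Fin.succEmb L) := by simp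
  have hu : (Finset.univ : Finset (Fin (L + 1))) =
      insert 0 ((Finset.univ : Finset (Fin L)).map (Fin.succEmb L)) := by
    ext q
    refine Fin.cases ?_ (fun q => ?_) q <;> simp
  rw [hu, Finset.powersetCard_succ_insert h0, Finset.sum_union, add_comm,
    Finset.powersetCard_map, Finset.powersetCard_map, Finset.sum_map, Finset.sum_image,
    Finset.sum_map]
  · rfl
  · intro s hs t ht hst
    have hs0 : (0 : Fin (L + 1)) ∉ s := by
      simp only [Finset.coe_map, Set.mem_image] at hs
      obtain ⟨s, _, rfl⟩ := hs
      simp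
    have ht0 : (0 : Fin (L + 1)) ∉ t := by
      simp only [Finset.coe_map, Set.mem_image] at ht
      obtain ⟨s, _, rfl⟩ := ht
      simp
    rw [← Finset.erase_insert hs0, ← Finset.erase_insert ht0, hst]
  · rw [Finset.disjoint_left]
    intro s hs hs'
    obtain ⟨t, _, rfl⟩ := Finset.mem_image.1 hs'
    exact h0 ((Finset.mem_powersetCard.1 hs).1 (Finset.mem_insert_self _ _))

/-- The sum of `f` over all shuffles of `u` and `v`, by recursion on the first letter. -/
def shuffleSum {α : Type*} : List α → List α → (List α → ℝ) → ℝ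
  | [], [], f => f []
  | a :: u, [], f => shuffleSum u [] fun w => f (a :: w)
  | [], b :: v, f => shuffleSum [] v fun w => f (b :: w)
  | a :: u, b :: v, f =>
      (shuffleSum u (b :: v) fun w => f (a :: w)) + shuffleSum (a :: u) v fun w => f (b :: w)
termination_by u v => u.length + v.length

lemma sum_interleave_eq_shuffleSum {α : Type*} (L : ℕ) :
    ∀ (u v : List α) (f : List α → ℝ), u.length + v.length = L →
      ∑ s ∈ Finset.powersetCard u.length (Finset.univ : Finset (Fin L)),
        f (interleave L u v s) = shuffleSum u v f := by
  induction L with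
  | zero =>
    intro u v f h
    obtain rfl : u = [] := List.length_eq_zero_iff.1 (by omega)
    obtain rfl : v = [] := List.length_eq_zero_iff.1 (by omega)
    simp [shuffleSum, interleave]
  | succ L ih =>
    intro u v f h
    match u, v with
    | [], [] => simp at h
    | a :: u, [] =>
      have hL : u.length = L := by simpa using h
      rw [List.length_cons, sum_powersetCard_univ_succ]
      rw [Finset.powersetCard_eq_empty.2 (by simp [hL] : _ < u.length + 1)]
      simp only [interleave_cons_left, Finset.sum_empty, add_zero]
      rw [shuffleSum, ← ih u [] _ (by simpa using h)]
    | [], b :: v =>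
      have := ih [] v (fun w => f (b :: w)) (by simpa using h)
      rw [shuffleSum, ← this]
      simp only [List.length_nil, Finset.powersetCard_zero, Finset.sum_singleton]
      rw [← interleave_cons_right]
      simp
    | a :: u, b :: v =>
      rw [List.length_cons, sum_powersetCard_univ_succ]
      simp only [interleave_cons_left, interleave_cons_right]
      rw [shuffleSum, ← ih u (b :: v) _ (by simp at h ⊢; omega),
        ← ih (a :: u) v _ (by simp at h ⊢; omega)]
      rfl

lemma IsGrouplike.mul_eq_shuffleSum {d : ℕ} {x : List (Fin d) → ℝ} (hx : IsGrouplike x)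
    (u v : List (Fin d)) : x u * x v = shuffleSum u v x := by
  rw [hx.2 u v, ← sum_interleave_eq_shuffleSum _ u v x rfl]
  rfl

/-- The shuffle coproduct pairing: `(c ⋆ c') w` sums `c u * c' v` over all ways to split `w` into
complementary subwords `u` and `v`. -/
def dualShuffle {α : Type*} : (List α → ℝ) → (List α → ℝ) → List α → ℝ
  | c, c', [] => c [] * c' []
  | c, c', a :: w =>
      dualShuffle (fun u => c (a :: u)) c' w + dualShuffle c (fun v => c' (a :: v)) w

/-- The sum of `g` over all words of length `n`. -/
def levelSum {d : ℕ} (n : ℕ) (g : List (Fin d) → ℝ) : ℝ :=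
  ∑ f : Fin n → Fin d, g (List.ofFn f)

lemma levelSum_zero {d : ℕ} (g : List (Fin d) → ℝ) : levelSum 0 g = g [] := by
  simp [levelSum]

lemma levelSum_succ {d : ℕ} (n : ℕ) (g : List (Fin d) → ℝ) :
    levelSum (n + 1) g = ∑ a, levelSum n fun w => g (a :: w) := by
  unfold levelSum
  rw [← (Fin.consEquiv fun _ => Fin d).sum_comp, Fintype.sum_prod_type]
  simp [Fin.consEquiv]

lemma levelSum_add {d : ℕ} (n : ℕ) (g h : List (Fin d) → ℝ) :
    levelSum n (fun w => g w + h w) = levelSum n g + levelSum n h :=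
  Finset.sum_add_distrib

lemma levelSum_sum {d : ℕ} {ι : Type*} (s : Finset ι) (n : ℕ) (g : ι → List (Fin d) → ℝ) :
    levelSum n (fun w => ∑ i ∈ s, g i w) = ∑ i ∈ s, levelSum n (g i) :=
  Finset.sum_comm

lemma levelSum_mul_left {d : ℕ} (n : ℕ) (t : ℝ) (g : List (Fin d) → ℝ) :
    levelSum n (fun w => t * g w) = t * levelSum n g :=
  (Finset.mul_sum _ _ _).symm

lemma levelSum_mul_right {d : ℕ} (n : ℕ) (t : ℝ) (g : List (Fin d) → ℝ) :
    levelSum n (fun w => g w * t) = levelSum n g * t :=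
  (Finset.sum_mul _ _ _).symm

/-- The pairing of `c ⊗ c'` with shuffles, restricted to words of lengths `i` and `j`. -/
def shufflePairing {d : ℕ} (i j : ℕ) (c c' f : List (Fin d) → ℝ) : ℝ :=
  levelSum i fun u => levelSum j fun v => c u * c' v * shuffleSum u v f

/-- The part of `shufflePairing` where the shuffle starts with a letter of the first word. -/
def shufflePairingLeft {d : ℕ} : ℕ → ℕ → (c c' f : List (Fin d) → ℝ) → ℝ
  | 0, _, _, _, _ => 0
  | i + 1, j, c, c', f =>
      ∑ a, shufflePairing i j (fun u => c (a :: u)) c' fun w => f (a :: w)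

/-- The part of `shufflePairing` where the shuffle starts with a letter of the second word. -/
def shufflePairingRight {d : ℕ} : ℕ → ℕ → (c c' f : List (Fin d) → ℝ) → ℝ
  | _, 0, _, _, _ => 0
  | i, j + 1, c, c', f =>
      ∑ a, shufflePairing i j c (fun v => c' (a :: v)) fun w => f (a :: w)

lemma shufflePairing_eq_left_add_right {d : ℕ} (i j : ℕ) (h : i + j ≠ 0)
    (c c' f : List (Fin d) → ℝ) :
    shufflePairing i j c c' f = shufflePairingLeft i j c c' f + shufflePairingRight i j c c' f := by
  match i, j with
  | 0, 0 => simp at h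
  | i + 1, 0 =>
    simp only [shufflePairing, shufflePairingLeft, shufflePairingRight, levelSum_succ,
      levelSum_zero, shuffleSum, add_zero]
  | 0, j + 1 =>
    simp only [shufflePairing, shufflePairingLeft, shufflePairingRight, levelSum_succ,
      levelSum_zero, shuffleSum, zero_add]
  | i + 1, j + 1 =>
    simp only [shufflePairing, shufflePairingLeft, shufflePairingRight]
    simp only [levelSum_succ, shuffleSum, mul_add, levelSum_add, Finset.sum_add_distrib,
      levelSum_sum]
    congr 1
    exact Finset.sum_comm

lemma levelSum_dualShuffle {d : ℕ} (n : ℕ) : ∀ c c' f : List (Fin d) → ℝ,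
    levelSum n (fun w => dualShuffle c c' w * f w) =
      ∑ p ∈ Finset.HasAntidiagonal.antidiagonal n, shufflePairing p.1 p.2 c c' f := by
  induction n with
  | zero =>
    intro c c' f
    simp [levelSum_zero, shufflePairing, dualShuffle, shuffleSum]
  | succ n ih =>
    intro c c' f
    have h : ∑ p ∈ Finset.HasAntidiagonal.antidiagonal (n + 1), shufflePairing p.1 p.2 c c' f =
        ∑ p ∈ Finset.HasAntidiagonal.antidiagonal (n + 1),
          (shufflePairingLeft p.1 p.2 c c' f + shufflePairingRight p.1 p.2 c c' f) := by
      refine Finset.sum_congr rfl fun p hp => shufflePairing_eq_left_add_right _ _ ?_ _ _ _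
      rw [Finset.HasAntidiagonal.mem_antidiagonal.1 hp]
      exact Nat.succ_ne_zero n
    rw [h, Finset.sum_add_distrib, Finset.Nat.sum_antidiagonal_succ,
      Finset.Nat.sum_antidiagonal_succ' (f := fun p => shufflePairingRight p.1 p.2 c c' f)]
    simp only [shufflePairingLeft, shufflePairingRight, zero_add]
    rw [Finset.sum_comm, Finset.sum_comm (s := Finset.HasAntidiagonal.antidiagonal n), levelSum_succ]
    simp only [dualShuffle, add_mul, levelSum_add, Finset.sum_add_distrib, ih]

lemma IsGrouplike.levelSum_dualShuffle {d : ℕ} {x : List (Fin d) → ℝ} (hx : IsGrouplike x)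
    (n : ℕ) (c c' : List (Fin d) → ℝ) :
    levelSum n (fun w => dualShuffle c c' w * x w) =
      ∑ p ∈ Finset.HasAntidiagonal.antidiagonal n,
        levelSum p.1 (fun w => c w * x w) * levelSum p.2 (fun w => c' w * x w) := by
  rw [_root_.levelSum_dualShuffle]
  refine Finset.sum_congr rfl fun p _ => ?_
  rw [shufflePairing, ← levelSum_mul_right]
  congr 1
  funext u
  rw [← levelSum_mul_left]
  congr 1
  funext v
  rw [← hx.mul_eq_shuffleSum]
  ring

/-- `c` grows at most exponentially in the length of the word. -/
def HasExpGrowth {d : ℕ} (c : List (Fin d) → ℝ) : Prop :=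
  ∃ C K : ℝ, 0 ≤ C ∧ 0 ≤ K ∧ ∀ w, |c w| ≤ K * C ^ w.length

/-- `x` decays faster than any exponential in the length of the word. -/
def HasSuperExpDecay {d : ℕ} (x : List (Fin d) → ℝ) : Prop :=
  ∀ ε : ℝ, 0 < ε → ∃ K : ℝ, ∀ w, |x w| ≤ K * ε ^ w.length

/-- The value at `x` of the linear functional with coefficients `c`, summed level by level. -/
noncomputable def pairing {d : ℕ} (c x : List (Fin d) → ℝ) : ℝ :=
  ∑' n, levelSum n fun w => c w * x w

lemma abs_levelSum_le {d : ℕ} (n : ℕ) (g : List (Fin d) → ℝ) :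
    |levelSum n g| ≤ levelSum n fun w => |g w| :=
  Finset.abs_sum_le_sum_abs _ _

lemma levelSum_le {d : ℕ} (n : ℕ) (g : List (Fin d) → ℝ) (B : ℝ)
    (h : ∀ w, w.length = n → g w ≤ B) : levelSum n g ≤ d ^ n * B := by
  unfold levelSum
  refine (Finset.sum_le_sum fun f _ => h _ (List.length_ofFn)).trans ?_
  simp

lemma summable_geometric_bound {d : ℕ} {C : ℝ} (hC : 0 ≤ C) (K : ℝ) :
    ∃ ε : ℝ, 0 < ε ∧ Summable fun n : ℕ => (d : ℝ) ^ n * (K * (C * ε) ^ n) := by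
  have hp : 0 < (d : ℝ) * C + 1 := by positivity
  refine ⟨1 / (d * C + 1), by positivity, ?_⟩
  have h : Summable fun n : ℕ => K * ((d : ℝ) * C * (1 / (d * C + 1))) ^ n := by
    refine (summable_geometric_of_lt_one (by positivity) ?_).mul_left K
    rw [mul_one_div, div_lt_one hp]
    linarith
  refine h.congr fun n => ?_
  rw [mul_assoc (d : ℝ), mul_pow (d : ℝ)]
  ring

lemma summable_levelSum_abs {d : ℕ} {c x : List (Fin d) → ℝ} (hc : HasExpGrowth c)
    (hx : HasSuperExpDecay x) : Summable fun n => levelSum n fun w => |c w * x w| := by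
  obtain ⟨C, K, hC, hK, hc⟩ := hc
  obtain ⟨ε, hε, hs⟩ := summable_geometric_bound (d := d) hC 1
  obtain ⟨K', hx⟩ := hx ε hε
  refine Summable.of_nonneg_of_le (fun n => Finset.sum_nonneg fun _ _ => abs_nonneg _)
    (fun n => levelSum_le n _ (K * K' * (C * ε) ^ n) ?_) ?_
  · rintro w rfl
    rw [abs_mul, mul_pow]
    calc |c w| * |x w| ≤ (K * C ^ w.length) * (K' * ε ^ w.length) :=
          mul_le_mul (hc w) (hx w) (abs_nonneg _) (by positivity)
      _ = _ := by ring
  · refine (hs.mul_left (K * K')).congr fun n => ?_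
    ring

lemma summable_norm_levelSum {d : ℕ} {c x : List (Fin d) → ℝ} (hc : HasExpGrowth c)
    (hx : HasSuperExpDecay x) : Summable fun n => ‖levelSum n fun w => c w * x w‖ :=
  Summable.of_nonneg_of_le (fun _ => norm_nonneg _) (fun n => abs_levelSum_le n _)
    (summable_levelSum_abs hc hx)

lemma summable_levelSum {d : ℕ} {c x : List (Fin d) → ℝ} (hc : HasExpGrowth c)
    (hx : HasSuperExpDecay x) : Summable fun n => levelSum n fun w => c w * x w :=
  (summable_norm_levelSum hc hx).of_norm

lemma abs_dualShuffle_le {d : ℕ} {C C' : ℝ} (hC : 0 ≤ C) (hC' : 0 ≤ C') (w : List (Fin d)) :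
    ∀ (c c' : List (Fin d) → ℝ) (K K' : ℝ), 0 ≤ K → 0 ≤ K' →
      (∀ w, |c w| ≤ K * C ^ w.length) → (∀ w, |c' w| ≤ K' * C' ^ w.length) →
      |dualShuffle c c' w| ≤ K * K' * (C + C') ^ w.length := by
  induction w with
  | nil =>
    intro c c' K K' hK hK' h h'
    have h0 := h []
    have h0' := h' []
    simp only [List.length_nil, pow_zero, mul_one] at h0 h0'
    simpa [dualShuffle, abs_mul] using mul_le_mul h0 h0' (abs_nonneg _) hK
  | cons a w ih =>
    intro c c' K K' hK hK' h h'
    have h1 := ih (fun u => c (a :: u)) c' (K * C) K' (by positivity) hK'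
      (fun u => (h (a :: u)).trans_eq (by simp [pow_succ]; ring)) h'
    have h2 := ih c (fun v => c' (a :: v)) K (K' * C') hK (by positivity) h
      (fun v => (h' (a :: v)).trans_eq (by simp [pow_succ]; ring))
    refine (abs_add_le _ _).trans ((add_le_add h1 h2).trans_eq ?_)
    simp [pow_succ]
    ring

lemma HasExpGrowth.dualShuffle {d : ℕ} {c c' : List (Fin d) → ℝ} (hc : HasExpGrowth c)
    (hc' : HasExpGrowth c') : HasExpGrowth (dualShuffle c c') := by
  obtain ⟨C, K, hC, hK, hc⟩ := hc
  obtain ⟨C', K', hC', hK', hc'⟩ := hc'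
  exact ⟨C + C', K * K', by positivity, by positivity, fun w =>
    abs_dualShuffle_le hC hC' w c c' K K' hK hK' hc hc'⟩

lemma HasExpGrowth.const_mul {d : ℕ} {c : List (Fin d) → ℝ} (hc : HasExpGrowth c) (t : ℝ) :
    HasExpGrowth fun w => t * c w := by
  obtain ⟨C, K, hC, hK, hc⟩ := hc
  refine ⟨C, |t| * K, hC, by positivity, fun w => ?_⟩
  rw [abs_mul, mul_assoc]
  gcongr
  exact hc w

lemma HasExpGrowth.add {d : ℕ} {c c' : List (Fin d) → ℝ} (hc : HasExpGrowth c)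
    (hc' : HasExpGrowth c') : HasExpGrowth fun w => c w + c' w := by
  obtain ⟨C, K, hC, hK, hc⟩ := hc
  obtain ⟨C', K', hC', hK', hc'⟩ := hc'
  refine ⟨max C C', K + K', by positivity, by positivity, fun w => ?_⟩
  refine (abs_add_le _ _).trans ((add_le_add (hc w) (hc' w)).trans ?_)
  rw [add_mul]
  gcongr
  · exact le_max_left _ _
  · exact le_max_right _ _

lemma hasExpGrowth_zero {d : ℕ} : HasExpGrowth fun _ : List (Fin d) => (0 : ℝ) :=
  ⟨0, 0, le_rfl, le_rfl, fun w => by simp⟩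

lemma HasExpGrowth.sum {d : ℕ} {ι : Type*} (s : Finset ι) {c : ι → List (Fin d) → ℝ}
    (hc : ∀ i, HasExpGrowth (c i)) : HasExpGrowth fun w => ∑ i ∈ s, c i w := by
  classical
  induction s using Finset.induction_on with
  | empty => simpa using hasExpGrowth_zero
  | insert a s ha ih =>
    simp only [Finset.sum_insert ha]
    exact (hc a).add ih

lemma pairing_dualShuffle {d : ℕ} {c c' x : List (Fin d) → ℝ} (hc : HasExpGrowth c)
    (hc' : HasExpGrowth c') (hG : IsGrouplike x) (hx : HasSuperExpDecay x) :
    pairing (dualShuffle c c') x = pairing c x * pairing c' x := by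
  unfold pairing
  rw [tsum_mul_tsum_eq_tsum_sum_antidiagonal_of_summable_norm (summable_norm_levelSum hc hx)
    (summable_norm_levelSum hc' hx)]
  simp only [hG.levelSum_dualShuffle]

lemma pairing_sum {d : ℕ} {ι : Type*} (s : Finset ι) {c : ι → List (Fin d) → ℝ}
    {x : List (Fin d) → ℝ} (hc : ∀ i, HasExpGrowth (c i)) (hx : HasSuperExpDecay x) :
    pairing (fun w => ∑ i ∈ s, c i w) x = ∑ i ∈ s, pairing (c i) x := by
  unfold pairing
  rw [← Summable.tsum_finsetSum fun i _ => summable_levelSum (hc i) hx]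
  simp only [Finset.sum_mul, levelSum_sum]

lemma pairing_const_mul {d : ℕ} (t : ℝ) (c x : List (Fin d) → ℝ) :
    pairing (fun w => t * c w) x = t * pairing c x := by
  unfold pairing
  rw [← tsum_mul_left]
  simp only [mul_assoc, levelSum_mul_left]

/-- The coefficient functional of the empty word. -/
def emptyCoeff {d : ℕ} (w : List (Fin d)) : ℝ := if w = [] then 1 else 0

lemma hasExpGrowth_emptyCoeff {d : ℕ} : HasExpGrowth (emptyCoeff (d := d)) := by
  refine ⟨1, 1, zero_le_one, zero_le_one, fun w => ?_⟩
  unfold emptyCoeff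
  split_ifs <;> simp

lemma levelSum_congr {d : ℕ} (n : ℕ) {g h : List (Fin d) → ℝ}
    (H : ∀ w, w.length = n → g w = h w) : levelSum n g = levelSum n h :=
  Finset.sum_congr rfl fun _ _ => H _ List.length_ofFn

lemma levelSum_eq_zero {d : ℕ} (n : ℕ) (g : List (Fin d) → ℝ)
    (h : ∀ w, w.length = n → g w = 0) : levelSum n g = 0 :=
  Finset.sum_eq_zero fun _ _ => h _ List.length_ofFn

lemma pairing_emptyCoeff {d : ℕ} (x : List (Fin d) → ℝ) : pairing emptyCoeff x = x [] := by
  unfold pairing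
  rw [tsum_eq_single 0]
  · simp [levelSum_zero, emptyCoeff]
  · intro n hn
    refine levelSum_eq_zero n _ fun w hw => ?_
    rw [emptyCoeff, if_neg, zero_mul]
    rintro rfl
    exact hn hw.symm

/-- The iterated dual shuffle power of `c`. -/
def dualShufflePow {d : ℕ} (c : List (Fin d) → ℝ) : ℕ → List (Fin d) → ℝ
  | 0 => emptyCoeff
  | n + 1 => dualShuffle (dualShufflePow c n) c

lemma HasExpGrowth.dualShufflePow {d : ℕ} {c : List (Fin d) → ℝ} (hc : HasExpGrowth c) (n : ℕ) :
    HasExpGrowth (dualShufflePow c n) := by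
  induction n with
  | zero => exact hasExpGrowth_emptyCoeff
  | succ n ih => exact ih.dualShuffle hc

lemma pairing_dualShufflePow {d : ℕ} {c x : List (Fin d) → ℝ} (hc : HasExpGrowth c)
    (hG : IsGrouplike x) (hx : HasSuperExpDecay x) (n : ℕ) :
    pairing (dualShufflePow c n) x = pairing c x ^ n := by
  induction n with
  | zero => rw [dualShufflePow, pairing_emptyCoeff, hG.1, pow_zero]
  | succ n ih => rw [dualShufflePow, pairing_dualShuffle (hc.dualShufflePow n) hc hG hx, ih, pow_succ]

lemma dualShuffle_sum_mul_left {d : ℕ} {ι : Type*} [Fintype ι] (t : ι → ℝ) (w : List (Fin d)) :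
    ∀ (c : ι → List (Fin d) → ℝ) (c' : List (Fin d) → ℝ),
      dualShuffle (fun u => ∑ i, t i * c i u) c' w = ∑ i, t i * dualShuffle (c i) c' w := by
  induction w with
  | nil => intro c c'; simp [dualShuffle, Finset.sum_mul, mul_assoc]
  | cons a w ih =>
    intro c c'
    simp only [dualShuffle, mul_add, Finset.sum_add_distrib]
    rw [ih c, ih fun i u => c i (a :: u)]

lemma dualShuffle_sum_mul_right {d : ℕ} {ι : Type*} [Fintype ι] (t : ι → ℝ) (w : List (Fin d)) :
    ∀ (c : List (Fin d) → ℝ) (c' : ι → List (Fin d) → ℝ),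
      dualShuffle c (fun u => ∑ i, t i * c' i u) w = ∑ i, t i * dualShuffle c (c' i) w := by
  induction w with
  | nil => intro c c'; simp [dualShuffle, Finset.mul_sum, mul_left_comm]
  | cons a w ih =>
    intro c c'
    simp only [dualShuffle, mul_add, Finset.sum_add_distrib]
    rw [ih _ c', ih _ fun i u => c' i (a :: u)]

/-- The `(i, j)` matrix coefficient of the representation of words sending the letter `a` to
`A a`. -/
def matrixCoeff {d : ℕ} {ι : Type*} [Fintype ι] [DecidableEq ι] (A : Fin d → Matrix ι ι ℝ)
    (i j : ι) : List (Fin d) → ℝ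
  | [] => if i = j then 1 else 0
  | a :: w => ∑ m, A a i m * matrixCoeff A m j w

lemma abs_matrixCoeff_le {d : ℕ} {ι : Type*} [Fintype ι] [DecidableEq ι]
    (A : Fin d → Matrix ι ι ℝ) (j : ι) (w : List (Fin d)) :
    ∀ i, |matrixCoeff A i j w| ≤ (∑ a, ∑ i, ∑ m, |A a i m|) ^ w.length := by
  induction w with
  | nil =>
    intro i
    unfold matrixCoeff
    split_ifs <;> simp
  | cons a w ih =>
    intro i
    set C := ∑ a, ∑ i, ∑ m, |A a i m|
    have hC : ∑ m, |A a i m| ≤ C :=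
      (Finset.single_le_sum (f := fun i => ∑ m, |A a i m|)
        (fun _ _ => by positivity) (Finset.mem_univ i)).trans
      (Finset.single_le_sum (f := fun a => ∑ i, ∑ m, |A a i m|)
        (fun _ _ => by positivity) (Finset.mem_univ a))
    calc |matrixCoeff A i j (a :: w)| ≤ ∑ m, |A a i m * matrixCoeff A m j w| :=
          Finset.abs_sum_le_sum_abs _ _
      _ ≤ ∑ m, |A a i m| * C ^ w.length := by
          refine Finset.sum_le_sum fun m _ => ?_
          rw [abs_mul]
          gcongr
          exact ih m
      _ ≤ C * C ^ w.length := by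
          rw [← Finset.sum_mul]
          gcongr
      _ = C ^ (a :: w).length := by rw [List.length_cons, pow_succ']

lemma hasExpGrowth_matrixCoeff {d : ℕ} {ι : Type*} [Fintype ι] [DecidableEq ι]
    (A : Fin d → Matrix ι ι ℝ) (i j : ι) : HasExpGrowth (matrixCoeff A i j) :=
  ⟨∑ a, ∑ i, ∑ m, |A a i m|, 1, by positivity, zero_le_one, fun w => by
    rw [one_mul]; exact abs_matrixCoeff_le A j w i⟩

lemma sum_dualShuffle_matrixCoeff {d : ℕ} {ι : Type*} [Fintype ι] [DecidableEq ι]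
    {A : Fin d → Matrix ι ι ℝ} (hA : ∀ a i j, A a i j = -A a j i) (w : List (Fin d)) :
    ∀ i l, ∑ j, dualShuffle (matrixCoeff A i j) (matrixCoeff A l j) w =
      if i = l then emptyCoeff w else 0 := by
  induction w with
  | nil =>
    intro i l
    simp [dualShuffle, matrixCoeff, emptyCoeff]
  | cons a w ih =>
    intro i l
    simp only [dualShuffle, matrixCoeff, dualShuffle_sum_mul_left, dualShuffle_sum_mul_right,
      Finset.sum_add_distrib]
    rw [Finset.sum_comm]
    nth_rewrite 2 [Finset.sum_comm]
    simp only [← Finset.mul_sum, ih]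
    by_cases hw : w = [] <;> simp [emptyCoeff, hA a i l, hw]

lemma abs_pairing_matrixCoeff_le_one {d : ℕ} {ι : Type*} [Fintype ι] [DecidableEq ι]
    {A : Fin d → Matrix ι ι ℝ} (hA : ∀ a i j, A a i j = -A a j i) (i j : ι)
    {x : List (Fin d) → ℝ} (hG : IsGrouplike x) (hx : HasSuperExpDecay x) :
    |pairing (matrixCoeff A i j) x| ≤ 1 := by
  have h : ∑ j, pairing (matrixCoeff A i j) x ^ 2 = 1 := by
    have hg := fun j => hasExpGrowth_matrixCoeff A i j
    simp only [sq, ← pairing_dualShuffle (hg _) (hg _) hG hx]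
    rw [← pairing_sum _ (fun j => (hg j).dualShuffle (hg j)) hx]
    simp only [sum_dualShuffle_matrixCoeff hA, if_true]
    rw [pairing_emptyCoeff, hG.1]
  rw [← sq_le_one_iff_abs_le_one, ← h]
  exact Finset.single_le_sum (f := fun j => pairing (matrixCoeff A i j) x ^ 2)
    (fun _ _ => sq_nonneg _) (Finset.mem_univ j)

/-- Antisymmetric matrices whose representation detects the word `w₀`, scaled by `t`: the letter
`a` links the positions `i` and `i + 1` whenever `a` is the `i`-th letter of `w₀`. -/
def pathMatrix {d : ℕ} (w₀ : List (Fin d)) (t : ℝ) (a : Fin d) :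
    Matrix (Fin (w₀.length + 1)) (Fin (w₀.length + 1)) ℝ :=
  fun i j =>
    if (j : ℕ) = i + 1 ∧ w₀[(i : ℕ)]? = some a then t
    else if (i : ℕ) = j + 1 ∧ w₀[(j : ℕ)]? = some a then -t else 0

lemma pathMatrix_antisymm {d : ℕ} (w₀ : List (Fin d)) (t : ℝ) (a : Fin d)
    (i j : Fin (w₀.length + 1)) : pathMatrix w₀ t a i j = -pathMatrix w₀ t a j i := by
  unfold pathMatrix
  split_ifs <;> first | omega | simp

/-- The coefficients of the functional extracting `w₀` to leading order in `t`. -/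
def pathCoeff {d : ℕ} (w₀ : List (Fin d)) (t : ℝ) : List (Fin d) → ℝ :=
  matrixCoeff (pathMatrix w₀ t) 0 (Fin.last _)

lemma matrixCoeff_pathMatrix_smul {d : ℕ} (w₀ : List (Fin d)) (t : ℝ) (w : List (Fin d)) :
    ∀ i j, matrixCoeff (pathMatrix w₀ t) i j w =
      t ^ w.length * matrixCoeff (pathMatrix w₀ 1) i j w := by
  induction w with
  | nil => intro i j; simp [matrixCoeff]
  | cons a w ih =>
    intro i j
    simp only [matrixCoeff, ih, Finset.mul_sum]
    refine Finset.sum_congr rfl fun m _ => ?_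
    have h : pathMatrix w₀ t a i m = t * pathMatrix w₀ 1 a i m := by
      unfold pathMatrix
      split_ifs <;> simp
    rw [h, List.length_cons]
    ring

lemma matrixCoeff_pathMatrix {d : ℕ} (w₀ w : List (Fin d)) :
    ∀ i : Fin (w₀.length + 1), i + w.length ≤ w₀.length →
      matrixCoeff (pathMatrix w₀ 1) i (Fin.last _) w = if w = w₀.drop i then 1 else 0 := by
  induction w with
  | nil =>
    intro i hi
    simp only [matrixCoeff]
    congr 1
    rw [eq_comm (a := []), List.drop_eq_nil_iff, Fin.ext_iff, Fin.val_last, eq_iff_iff]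
    simp at hi
    omega
  | cons a w ih =>
    intro i hi
    rw [List.length_cons] at hi
    have hi' : (i : ℕ) < w₀.length := by omega
    simp only [matrixCoeff]
    rw [Finset.sum_eq_single (⟨i + 1, by omega⟩ : Fin (w₀.length + 1))]
    · rw [ih _ (by simp; omega), List.drop_eq_getElem_cons hi']
      simp only [pathMatrix, List.getElem?_eq_getElem hi', List.cons.injEq, Option.some.injEq]
      by_cases h1 : a = w₀[(i : ℕ)] <;> by_cases h2 : w = List.drop (i + 1) w₀ <;>
        simp [h1, h2, eq_comm (b := a), show ¬((i : ℕ) = i + 1 + 1) by omega]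
    · intro m _ hm
      have hm' : (m : ℕ) ≠ i + 1 := fun h => hm (Fin.ext h)
      by_cases hmi : (i : ℕ) = m + 1
      · rw [ih m (by omega), if_neg, mul_zero]
        intro h
        have := congrArg List.length h
        rw [List.length_drop] at this
        omega
      · simp [pathMatrix, hm', hmi]
    · simp

lemma pathCoeff_eq {d : ℕ} (w₀ : List (Fin d)) (t : ℝ) (w : List (Fin d)) :
    pathCoeff w₀ t w = t ^ w.length * pathCoeff w₀ 1 w :=
  matrixCoeff_pathMatrix_smul w₀ t w _ _

lemma pathCoeff_one_of_length_le {d : ℕ} (w₀ w : List (Fin d)) (h : w.length ≤ w₀.length) :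
    pathCoeff w₀ 1 w = if w = w₀ then 1 else 0 := by
  simpa [pathCoeff] using matrixCoeff_pathMatrix w₀ w 0 (by simpa using h)

lemma levelSum_ite_eq {d : ℕ} (w₀ : List (Fin d)) (g : List (Fin d) → ℝ) :
    levelSum w₀.length (fun w => if w = w₀ then g w else 0) = g w₀ := by
  unfold levelSum
  rw [Finset.sum_eq_single w₀.get]
  · simp
  · intro f _ hf
    refine if_neg fun h => ?_
    exact hf (List.ofFn_injective (by rw [h, List.ofFn_get]))
  · simp

lemma tendsto_pairing_pathCoeff {d : ℕ} (w₀ : List (Fin d)) {x : List (Fin d) → ℝ}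
    (hx : HasSuperExpDecay x) {t : ℕ → ℝ} (ht0 : ∀ m, 0 < t m) (ht1 : ∀ m, t m ≤ 1)
    (ht : Tendsto t atTop (nhds 0)) :
    Tendsto (fun m => (t m ^ w₀.length)⁻¹ * pairing (pathCoeff w₀ (t m)) x) atTop
      (nhds (x w₀)) := by
  set k := w₀.length
  set b : ℕ → ℝ := fun n => levelSum n fun w => pathCoeff w₀ 1 w * x w
  have hg : ∀ s, HasExpGrowth (pathCoeff w₀ s) := fun s => hasExpGrowth_matrixCoeff _ _ _
  have hb : Summable fun n => |b n| := summable_norm_levelSum (hg 1) hx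
  have hlev : ∀ s n, (levelSum n fun w => pathCoeff w₀ s w * x w) = s ^ n * b n := by
    intro s n
    rw [← levelSum_mul_left]
    refine levelSum_congr n fun w hw => ?_
    rw [pathCoeff_eq, hw, mul_assoc]
  have hlow : ∀ n < k, b n = 0 := fun n hn => levelSum_eq_zero n _ fun w hw => by
    rw [pathCoeff_one_of_length_le w₀ w (by omega), if_neg, zero_mul]
    rintro rfl
    omega
  have hk : b k = x w₀ := by
    rw [← levelSum_ite_eq w₀ x]
    refine levelSum_congr k fun w hw => ?_
    rw [pathCoeff_one_of_length_le w₀ w hw.le, ite_mul, one_mul, zero_mul]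
  have hbound : ∀ m, |(t m ^ k)⁻¹ * pairing (pathCoeff w₀ (t m)) x - x w₀| ≤
      t m * ∑' n, |b (n + (k + 1))| := by
    intro m
    have hs : Summable fun n => t m ^ n * b n :=
      (summable_levelSum (hg (t m)) hx).congr fun n => hlev _ n
    have hsplit : pairing (pathCoeff w₀ (t m)) x =
        t m ^ k * x w₀ + t m ^ k * (t m * ∑' n, t m ^ n * b (n + (k + 1))) := by
      unfold pairing
      simp only [hlev]
      rw [← hs.sum_add_tsum_nat_add (k + 1), Finset.sum_range_succ, hk,
        Finset.sum_eq_zero fun n hn => by rw [hlow n (Finset.mem_range.1 hn), mul_zero], zero_add,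
        ← mul_assoc, ← tsum_mul_left]
      congr 1
      refine tsum_congr fun n => ?_
      rw [pow_add, pow_succ]
      ring
    have hpos : t m ^ k ≠ 0 := (pow_pos (ht0 m) k).ne'
    have hb' : Summable fun n => |b (n + (k + 1))| :=
      hb.comp_injective (add_left_injective (k + 1))
    have hle : ∀ n, |t m ^ n * b (n + (k + 1))| ≤ |b (n + (k + 1))| := fun n => by
      rw [abs_mul, abs_of_nonneg (pow_nonneg (ht0 m).le n)]
      exact mul_le_of_le_one_left (abs_nonneg _) (pow_le_one₀ (ht0 m).le (ht1 m))
    rw [hsplit, ← mul_add, inv_mul_cancel_left₀ hpos, add_sub_cancel_left, abs_mul,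
      abs_of_pos (ht0 m)]
    refine mul_le_mul_of_nonneg_left ?_ (ht0 m).le
    exact tsum_of_norm_bounded (f := fun n => t m ^ n * b (n + (k + 1))) hb'.hasSum hle
  rw [tendsto_iff_norm_sub_tendsto_zero]
  refine squeeze_zero (fun _ => norm_nonneg _) hbound ?_
  simpa using ht.mul_const (∑' n, |b (n + (k + 1))|)

/-- The coordinates are `μ`-integrable, and their first absolute moments decay faster than any
exponential in the length of the word. -/
def HasMomentDecay {d : ℕ} (μ : Measure (List (Fin d) → ℝ)) : Prop :=
  (∀ w, Integrable (fun x => x w) μ) ∧ HasSuperExpDecay fun w => ∫ x, |x w| ∂μ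

lemma le_levelSum {d : ℕ} {g : List (Fin d) → ℝ} (hg : ∀ w, 0 ≤ g w) (w : List (Fin d)) :
    g w ≤ levelSum w.length g := by
  have h := Finset.single_le_sum (f := fun f : Fin w.length → Fin d => g (List.ofFn f))
    (fun _ _ => hg _) (Finset.mem_univ w.get)
  rwa [List.ofFn_get] at h

lemma abs_le_levelNorm {d : ℕ} (x : List (Fin d) → ℝ) (w : List (Fin d)) :
    |x w| ≤ levelNorm x w.length :=
  Real.abs_le_sqrt (le_levelSum (g := fun w => x w ^ 2) (fun _ => sq_nonneg _) w)

lemma hasMomentDecay_of_radius {d : ℕ} {μ : Measure (List (Fin d) → ℝ)}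
    (hradius : ∀ r : ℝ, 0 < r →
      (∑' n : ℕ, ENNReal.ofReal (r ^ n) * ∫⁻ x, ENNReal.ofReal (levelNorm x n) ∂μ) < ⊤) :
    HasMomentDecay μ := by
  have hmeas : ∀ w, Measurable fun x : List (Fin d) → ℝ => x w := fun w => measurable_pi_apply w
  have hle : ∀ r : ℝ, ∀ w : List (Fin d),
      ENNReal.ofReal (r ^ w.length) * ∫⁻ x, ‖x w‖ₑ ∂μ ≤
        ∑' n : ℕ, ENNReal.ofReal (r ^ n) * ∫⁻ x, ENNReal.ofReal (levelNorm x n) ∂μ := by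
    intro r w
    refine le_trans ?_ (ENNReal.le_tsum w.length)
    gcongr with x
    rw [← ofReal_norm]
    exact ENNReal.ofReal_le_ofReal (abs_le_levelNorm x w)
  refine ⟨fun w => ⟨(hmeas w).aestronglyMeasurable, ?_⟩, fun ε hε => ?_⟩
  · have h := (hle 1 w).trans_lt (hradius 1 one_pos)
    rwa [one_pow, ENNReal.ofReal_one, one_mul] at h
  · refine ⟨(∑' n : ℕ, ENNReal.ofReal (ε⁻¹ ^ n) *
      ∫⁻ x, ENNReal.ofReal (levelNorm x n) ∂μ).toReal, fun w => ?_⟩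
    have h := ENNReal.toReal_mono (hradius ε⁻¹ (inv_pos.2 hε)).ne (hle ε⁻¹ w)
    rw [ENNReal.toReal_mul, ENNReal.toReal_ofReal (by positivity),
      ← integral_norm_eq_lintegral_enorm (hmeas w).aestronglyMeasurable, inv_pow,
      inv_mul_le_iff₀ (by positivity), mul_comm] at h
    rwa [abs_of_nonneg (integral_nonneg fun _ => abs_nonneg _)]

lemma integral_shuffleSum {d : ℕ} {Ω : Type*} [MeasurableSpace Ω] {ν : Measure Ω} (L : ℕ) :
    ∀ (u v : List (Fin d)) (g : List (Fin d) → Ω → ℝ), u.length + v.length = L →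
      (∀ w, Integrable (g w) ν) →
      Integrable (fun x => shuffleSum u v fun w => g w x) ν ∧
        ∫ x, shuffleSum u v (fun w => g w x) ∂ν = shuffleSum u v fun w => ∫ x, g w x ∂ν := by
  induction L with
  | zero =>
    intro u v g h hg
    obtain rfl : u = [] := List.length_eq_zero_iff.1 (by omega)
    obtain rfl : v = [] := List.length_eq_zero_iff.1 (by omega)
    simpa only [shuffleSum, and_true] using hg []
  | succ L ih =>
    intro u v g h hg
    match u, v with
    | [], [] => simp at h
    | a :: u, [] =>
      simp only [shuffleSum]
      exact ih u [] (fun w => g (a :: w)) (by simpa using h) fun _ => hg _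
    | [], b :: v =>
      simp only [shuffleSum]
      exact ih [] v (fun w => g (b :: w)) (by simpa using h) fun _ => hg _
    | a :: u, b :: v =>
      simp only [shuffleSum]
      obtain ⟨h1, h1'⟩ := ih u (b :: v) (fun w => g (a :: w)) (by simp at h ⊢; omega) fun _ => hg _
      obtain ⟨h2, h2'⟩ := ih (a :: u) v (fun w => g (b :: w)) (by simp at h ⊢; omega) fun _ => hg _
      exact ⟨h1.add h2, by rw [integral_add h1 h2, h1', h2']⟩

lemma shuffleSum_le {α : Type*} (B : ℝ) (hB : 0 ≤ B) (L : ℕ) :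
    ∀ (u v : List α) (f : List α → ℝ), u.length + v.length = L →
      (∀ w, w.length = L → f w ≤ B) → shuffleSum u v f ≤ 2 ^ L * B := by
  induction L with
  | zero =>
    intro u v f h hf
    obtain rfl : u = [] := List.length_eq_zero_iff.1 (by omega)
    obtain rfl : v = [] := List.length_eq_zero_iff.1 (by omega)
    simpa [shuffleSum] using hf [] rfl
  | succ L ih =>
    intro u v f h hf
    have h2 : (2 : ℝ) ^ (L + 1) * B = 2 ^ L * B + 2 ^ L * B := by ring
    have hpos : 0 ≤ 2 ^ L * B := by positivity
    have hf' : ∀ a w, w.length = L → f (a :: w) ≤ B := fun a w hw => hf _ (by simp [hw])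
    match u, v with
    | [], [] => simp at h
    | a :: u, [] =>
      rw [shuffleSum]
      linarith [ih u [] _ (by simpa using h) (hf' a)]
    | [], b :: v =>
      rw [shuffleSum]
      linarith [ih [] v _ (by simpa using h) (hf' b)]
    | a :: u, b :: v =>
      rw [shuffleSum]
      linarith [ih u (b :: v) _ (by simp at h ⊢; omega) (hf' a),
        ih (a :: u) v _ (by simp at h ⊢; omega) (hf' b)]

lemma HasMomentDecay.of_integral_eq {d : ℕ} {μ ν : Measure (List (Fin d) → ℝ)}
    [IsProbabilityMeasure ν] (hμ : HasMomentDecay μ) (hνG : ∀ᵐ x ∂ν, IsGrouplike x)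
    (hνint : ∀ w, Integrable (fun x => x w) ν)
    (hexp : ∀ w : List (Fin d), ∫ x, x w ∂ν = ∫ x, x w ∂μ) : HasMomentDecay ν := by
  refine ⟨hνint, fun ε hε => ?_⟩
  obtain ⟨K, hK⟩ := hμ.2 (ε / 2) (by positivity)
  have hK0 : 0 ≤ K := by simpa using (abs_nonneg _).trans (hK [])
  refine ⟨K + 1, fun w => ?_⟩
  rw [abs_of_nonneg (integral_nonneg fun _ => abs_nonneg _)]
  set n := w.length
  obtain ⟨hint, hval⟩ := integral_shuffleSum (ν := ν) (n + n) w w (fun w x => x w) rfl hνint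
  have hsq : (fun x => shuffleSum w w x) =ᵐ[ν] fun x => x w ^ 2 := by
    filter_upwards [hνG] with x hx
    rw [sq, hx.mul_eq_shuffleSum]
  have hint' : Integrable (fun x => x w ^ 2) ν := hint.congr hsq
  have hbound : ∫ x, x w ^ 2 ∂ν ≤ K * ε ^ (n + n) := by
    rw [← integral_congr_ae hsq, hval]
    refine (shuffleSum_le (K * (ε / 2) ^ (n + n)) (by positivity) (n + n) w w _ rfl
      fun v hv => ?_).trans_eq ?_
    · rw [hexp, ← hv]
      calc ∫ x, x v ∂μ ≤ |∫ x, x v ∂μ| := le_abs_self _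
        _ ≤ ∫ x, |x v| ∂μ := abs_integral_le_integral_abs
        _ ≤ |∫ x, |x v| ∂μ| := le_abs_self _
        _ ≤ _ := hK v
    · rw [div_pow]
      field_simp
  have hε' : 0 < ε ^ n := pow_pos hε n
  have hpt : ∀ y : ℝ, |y| ≤ (ε ^ n)⁻¹ * y ^ 2 + ε ^ n := fun y => by
    have h : |y| * ε ^ n ≤ y ^ 2 + ε ^ n * ε ^ n := by
      nlinarith [sq_nonneg (|y| - ε ^ n), sq_abs y, abs_nonneg y, sq_nonneg (|y| + ε ^ n)]
    rw [← sub_nonneg] at h ⊢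
    have : (ε ^ n)⁻¹ * y ^ 2 + ε ^ n - |y| =
        (ε ^ n)⁻¹ * (y ^ 2 + ε ^ n * ε ^ n - |y| * ε ^ n) := by field_simp
    rw [this]
    positivity
  calc ∫ x, |x w| ∂ν ≤ ∫ x, ((ε ^ n)⁻¹ * x w ^ 2 + ε ^ n) ∂ν :=
        integral_mono (hνint w).abs ((hint'.const_mul _).add (integrable_const _))
          fun x => hpt (x w)
    _ = (ε ^ n)⁻¹ * ∫ x, x w ^ 2 ∂ν + ε ^ n := by
        rw [integral_add (hint'.const_mul _) (integrable_const _), integral_const_mul]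
        simp
    _ ≤ (ε ^ n)⁻¹ * (K * ε ^ (n + n)) + ε ^ n := by gcongr
    _ = (K + 1) * ε ^ n := by
        rw [pow_add]
        field_simp

lemma integrable_levelSum {d : ℕ} {Ω : Type*} [MeasurableSpace Ω] {μ : Measure Ω} (n : ℕ)
    {g : List (Fin d) → Ω → ℝ} (hg : ∀ w, Integrable (g w) μ) :
    Integrable (fun x => levelSum n fun w => g w x) μ :=
  integrable_finsetSum _ fun _ _ => hg _

lemma integral_levelSum {d : ℕ} {Ω : Type*} [MeasurableSpace Ω] {μ : Measure Ω} (n : ℕ)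
    {g : List (Fin d) → Ω → ℝ} (hg : ∀ w, Integrable (g w) μ) :
    ∫ x, levelSum n (fun w => g w x) ∂μ = levelSum n fun w => ∫ x, g w x ∂μ :=
  integral_finsetSum _ fun _ _ => hg _

lemma HasMomentDecay.summable_integral_levelSum_abs {d : ℕ} {μ : Measure (List (Fin d) → ℝ)}
    (hμ : HasMomentDecay μ) {c : List (Fin d) → ℝ} (hc : HasExpGrowth c) :
    Summable fun n => ∫ x, levelSum n (fun w => |c w * x w|) ∂μ := by
  refine (summable_levelSum_abs hc hμ.2).congr fun n => ?_
  rw [integral_levelSum n fun w => ((hμ.1 w).const_mul (c w)).abs]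
  refine levelSum_congr n fun w _ => ?_
  simp only [abs_mul, integral_const_mul]
  rw [abs_of_nonneg (integral_nonneg fun _ => abs_nonneg _)]

lemma HasMomentDecay.ae_hasSuperExpDecay {d : ℕ} {μ : Measure (List (Fin d) → ℝ)}
    (hμ : HasMomentDecay μ) : ∀ᵐ x ∂μ, HasSuperExpDecay x := by
  have hstep : ∀ ε : ℝ, 0 < ε → ∀ᵐ x ∂μ, ∃ K, ∀ w, |x w| ≤ K * ε ^ w.length := by
    intro ε hε
    have hc : HasExpGrowth fun w : List (Fin d) => ε⁻¹ ^ w.length :=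
      ⟨ε⁻¹, 1, by positivity, zero_le_one, fun w => by
        rw [one_mul, abs_of_nonneg (by positivity)]⟩
    have hint : ∀ n, Integrable (fun x : List (Fin d) → ℝ =>
        levelSum n fun w => |ε⁻¹ ^ w.length * x w|) μ := fun n =>
      integrable_levelSum n fun w => ((hμ.1 w).const_mul _).abs
    have hnn : ∀ n (x : List (Fin d) → ℝ), 0 ≤ levelSum n fun w => |ε⁻¹ ^ w.length * x w| :=
      fun n x => Finset.sum_nonneg fun _ _ => abs_nonneg _
    have hsum : ∑' n, eLpNorm (fun x : List (Fin d) → ℝ =>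
        levelSum n fun w => |ε⁻¹ ^ w.length * x w|) 1 μ ≠ ⊤ := by
      simp only [eLpNorm_one_eq_lintegral_enorm, ← ofReal_integral_norm_eq_lintegral_enorm (hint _),
        Real.norm_of_nonneg (hnn _ _)]
      exact (hμ.summable_integral_levelSum_abs hc).tsum_ofReal_ne_top
    filter_upwards [summable_norm_of_tsum_eLpNorm_ne_top le_rfl
      (fun n => (hint n).aestronglyMeasurable) hsum] with x hx
    simp only [Real.norm_of_nonneg (hnn _ _)] at hx
    refine ⟨∑' n, levelSum n fun w => |ε⁻¹ ^ w.length * x w|, fun w => ?_⟩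
    have h := (le_levelSum (g := fun w => |ε⁻¹ ^ w.length * x w|) (fun _ => abs_nonneg _) w).trans
      (hx.le_tsum w.length fun n _ => hnn n x)
    rwa [abs_mul, abs_of_pos (by positivity), inv_pow, inv_mul_le_iff₀ (by positivity),
      mul_comm] at h
  have hall : ∀ᵐ x ∂μ, ∀ m : ℕ, ∃ K, ∀ w, |x w| ≤ K * (1 / ((m : ℝ) + 1)) ^ w.length :=
    ae_all_iff.2 fun m => hstep _ (by positivity)
  filter_upwards [hall] with x hx ε hε
  obtain ⟨m, hm⟩ := exists_nat_one_div_lt hε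
  obtain ⟨K, hK⟩ := hx m
  have hK0 : 0 ≤ K := by simpa using (abs_nonneg _).trans (hK [])
  refine ⟨K, fun w => (hK w).trans ?_⟩
  gcongr

lemma measurable_pairing {d : ℕ} (c : List (Fin d) → ℝ) : Measurable (pairing c) :=
  Measurable.tsum fun _ => Finset.measurable_sum _ fun _ _ =>
    (measurable_pi_apply _).const_mul _

lemma HasMomentDecay.integral_pairing {d : ℕ} {μ : Measure (List (Fin d) → ℝ)}
    (hμ : HasMomentDecay μ) {c : List (Fin d) → ℝ} (hc : HasExpGrowth c) :
    ∫ x, pairing c x ∂μ = pairing c fun w => ∫ x, x w ∂μ := by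
  have hint : ∀ w, Integrable (fun x : List (Fin d) → ℝ => c w * x w) μ :=
    fun w => (hμ.1 w).const_mul _
  unfold pairing
  rw [← integral_tsum_of_summable_integral_norm fun n => integrable_levelSum n hint]
  · simp only [integral_levelSum _ hint, integral_const_mul]
  · refine Summable.of_nonneg_of_le (fun n => integral_nonneg fun _ => norm_nonneg _)
      (fun n => ?_) (hμ.summable_integral_levelSum_abs hc)
    exact integral_mono (integrable_levelSum n hint).norm
      (integrable_levelSum n fun w => (hint w).abs) fun x => abs_levelSum_le n _

lemma hasSum_integral_cexp {Ω : Type*} [MeasurableSpace Ω] {μ : Measure Ω} [IsFiniteMeasure μ]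
    {h : Ω → ℝ} (hm : Measurable h) {M : ℝ} (hM : ∀ᵐ x ∂μ, |h x| ≤ M) :
    HasSum (fun n : ℕ => Complex.I ^ n / n.factorial * ((∫ x, h x ^ n ∂μ : ℝ) : ℂ))
      (∫ x, Complex.exp (h x * Complex.I) ∂μ) := by
  have key := hasSum_integral_of_dominated_convergence (μ := μ)
    (F := fun (n : ℕ) x => ((h x : ℂ) * Complex.I) ^ n / n.factorial)
    (f := fun x => Complex.exp (h x * Complex.I))
    (fun n _ => M ^ n / n.factorial) (fun n => by fun_prop)
    (fun n => by
      filter_upwards [hM] with x hx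
      simp only [norm_div, norm_pow, norm_mul, Complex.norm_real, Complex.norm_I, mul_one,
        Complex.norm_natCast, Real.norm_eq_abs]
      gcongr)
    (ae_of_all _ fun _ => Real.summable_pow_div_factorial M) (integrable_const _)
    (ae_of_all _ fun x => by
      rw [Complex.exp_eq_exp_ℂ]
      exact NormedSpace.expSeries_div_hasSum_exp _)
  suffices hcoeff : ∀ n : ℕ, Complex.I ^ n / n.factorial * ((∫ x, h x ^ n ∂μ : ℝ) : ℂ) =
      ∫ x, ((h x : ℂ) * Complex.I) ^ n / n.factorial ∂μ by simpa only [hcoeff] using key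
  intro n
  rw [← integral_complex_ofReal, ← integral_const_mul]
  congr 1
  funext x
  push_cast
  ring

lemma integral_cexp_pairing_eq {d : ℕ} {μ ν : Measure (List (Fin d) → ℝ)}
    [IsFiniteMeasure μ] [IsFiniteMeasure ν]
    (hμ : HasMomentDecay μ) (hν : HasMomentDecay ν)
    (hμG : ∀ᵐ x ∂μ, IsGrouplike x) (hνG : ∀ᵐ x ∂ν, IsGrouplike x)
    (hexp : ∀ w : List (Fin d), ∫ x, x w ∂ν = ∫ x, x w ∂μ)
    {c : List (Fin d) → ℝ} (hc : HasExpGrowth c) {M : ℝ}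
    (hM : ∀ x, IsGrouplike x → HasSuperExpDecay x → |pairing c x| ≤ M) :
    ∫ x, Complex.exp (pairing c x * Complex.I) ∂ν =
      ∫ x, Complex.exp (pairing c x * Complex.I) ∂μ := by
  have hmom : ∀ n : ℕ, ∫ x, pairing c x ^ n ∂ν = ∫ x, pairing c x ^ n ∂μ := by
    intro n
    have hpow : ∀ {ρ : Measure (List (Fin d) → ℝ)}, HasMomentDecay ρ →
        (∀ᵐ x ∂ρ, IsGrouplike x) →
        ∫ x, pairing c x ^ n ∂ρ = pairing (dualShufflePow c n) fun w => ∫ x, x w ∂ρ := by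
      intro ρ hρ hρG
      rw [← hρ.integral_pairing (hc.dualShufflePow n)]
      refine integral_congr_ae ?_
      filter_upwards [hρG, hρ.ae_hasSuperExpDecay] with x hG hx
      rw [pairing_dualShufflePow hc hG hx]
    rw [hpow hμ hμG, hpow hν hνG, funext hexp]
  have hbdd : ∀ {ρ : Measure (List (Fin d) → ℝ)}, HasMomentDecay ρ →
      (∀ᵐ x ∂ρ, IsGrouplike x) → ∀ᵐ x ∂ρ, |pairing c x| ≤ M := by
    intro ρ hρ hρG
    filter_upwards [hρG, hρ.ae_hasSuperExpDecay] with x hG hx using hM x hG hx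
  have h1 := hasSum_integral_cexp (measurable_pairing c) (hbdd hμ hμG)
  have h2 := hasSum_integral_cexp (measurable_pairing c) (hbdd hν hνG)
  simp only [hmom] at h2
  exact h2.unique h1

lemma integral_cexp_coordinates_eq {d : ℕ} {μ ν : Measure (List (Fin d) → ℝ)}
    [IsFiniteMeasure μ] [IsFiniteMeasure ν]
    (hμ : HasMomentDecay μ) (hν : HasMomentDecay ν)
    (hμG : ∀ᵐ x ∂μ, IsGrouplike x) (hνG : ∀ᵐ x ∂ν, IsGrouplike x)
    (hexp : ∀ w : List (Fin d), ∫ x, x w ∂ν = ∫ x, x w ∂μ)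
    {ι : Type*} [Fintype ι] (p : ι → List (Fin d)) (s : ι → ℝ) :
    ∫ x, Complex.exp ((∑ i, s i * x (p i) : ℝ) * Complex.I) ∂ν =
      ∫ x, Complex.exp ((∑ i, s i * x (p i) : ℝ) * Complex.I) ∂μ := by
  set t : ℕ → ℝ := fun m => 1 / ((m : ℝ) + 1)
  have ht0 : ∀ m, 0 < t m := fun m => by positivity
  have ht1 : ∀ m, t m ≤ 1 := fun m => by
    rw [div_le_one (by positivity)]
    linarith [(Nat.cast_nonneg m : (0 : ℝ) ≤ m)]
  have ht : Tendsto t atTop (nhds 0) := tendsto_one_div_add_atTop_nhds_zero_nat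
  set c : ℕ → ι → List (Fin d) → ℝ := fun m i w =>
    s i * (t m ^ (p i).length)⁻¹ * pathCoeff (p i) (t m) w
  have hgrow : ∀ m i, HasExpGrowth (c m i) := fun m i =>
    (hasExpGrowth_matrixCoeff _ _ _).const_mul _
  have hpair : ∀ m x, HasSuperExpDecay x → pairing (fun w => ∑ i, c m i w) x =
      ∑ i, s i * ((t m ^ (p i).length)⁻¹ * pairing (pathCoeff (p i) (t m)) x) := by
    intro m x hx
    rw [pairing_sum _ (hgrow m) hx]
    simp only [c, pairing_const_mul, mul_assoc]
  have heq : ∀ m, ∫ x, Complex.exp (pairing (fun w => ∑ i, c m i w) x * Complex.I) ∂ν =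
      ∫ x, Complex.exp (pairing (fun w => ∑ i, c m i w) x * Complex.I) ∂μ := by
    intro m
    refine integral_cexp_pairing_eq hμ hν hμG hνG hexp (HasExpGrowth.sum _ (hgrow m))
      (M := ∑ i, |s i| * |(t m ^ (p i).length)⁻¹|) fun x hG hx => ?_
    rw [hpair m x hx]
    refine (Finset.abs_sum_le_sum_abs _ _).trans (Finset.sum_le_sum fun i _ => ?_)
    rw [abs_mul, abs_mul, ← mul_assoc]
    exact mul_le_of_le_one_right (by positivity)
      (abs_pairing_matrixCoeff_le_one (pathMatrix_antisymm _ _) _ _ hG hx)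
  have hlim : ∀ {ρ : Measure (List (Fin d) → ℝ)} [IsFiniteMeasure ρ], HasMomentDecay ρ →
      Tendsto (fun m => ∫ x, Complex.exp (pairing (fun w => ∑ i, c m i w) x * Complex.I) ∂ρ) atTop
        (nhds (∫ x, Complex.exp ((∑ i, s i * x (p i) : ℝ) * Complex.I) ∂ρ)) := by
    intro ρ _ hρ
    refine tendsto_integral_of_dominated_convergence (fun _ => 1) (fun m => ?_)
      (integrable_const _) (fun m => ae_of_all _ fun x => ?_) ?_
    · have := measurable_pairing fun w => ∑ i, c m i w
      fun_prop
    · rw [Complex.norm_exp_ofReal_mul_I]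
    · filter_upwards [hρ.ae_hasSuperExpDecay] with x hx
      have hcont : Continuous fun y : ℝ => Complex.exp (y * Complex.I) := by fun_prop
      refine (hcont.tendsto _).comp ?_
      simp only [hpair _ x hx]
      exact tendsto_finsetSum _ fun i _ =>
        (tendsto_pairing_pathCoeff (p i) hx ht0 ht1 ht).const_mul (s i)
  refine tendsto_nhds_unique (hlim hν) ?_
  simp only [heq]
  exact hlim hμ

lemma measure_ext_of_integral_cexp_coordinates {κ : Type*} {μ ν : Measure (κ → ℝ)}
    [IsFiniteMeasure μ] [IsFiniteMeasure ν]
    (h : ∀ (I : Finset κ) (s : I → ℝ),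
      ∫ x, Complex.exp ((∑ i : I, s i * x i : ℝ) * Complex.I) ∂ν =
        ∫ x, Complex.exp ((∑ i : I, s i * x i : ℝ) * Complex.I) ∂μ) : ν = μ := by
  classical
  refine IsProjectiveLimit.unique (P := fun I => μ.map I.restrict) (fun I => ?_) fun I => rfl
  refine Measure.ext_of_charFunDual (funext fun L => ?_)
  have hL : ∀ y : I → ℝ, L y = ∑ i, L (Pi.single i 1) * y i := by
    intro y
    conv_lhs => rw [← Finset.univ_sum_single y, map_sum]
    refine Finset.sum_congr rfl fun i _ => ?_
    rw [mul_comm, ← smul_eq_mul, ← map_smul, ← Pi.single_smul, smul_eq_mul, mul_one]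
  have hm : ∀ ρ : Measure (κ → ℝ), charFunDual (ρ.map I.restrict) L =
      ∫ x, Complex.exp ((∑ i : I, L (Pi.single i 1) * x i : ℝ) * Complex.I) ∂ρ := by
    intro ρ
    rw [charFunDual_apply, integral_map (by fun_prop) (by fun_prop)]
    congr 1
    funext x
    rw [hL]
    rfl
  rw [hm, hm, h]

/-- Chevyrev–Lyons criterion: if a probability measure `μ` on the grouplike
elements satisfies `Σₙ rⁿ E_μ‖xₙ‖ < ∞` for every `r > 0` (the power series
`Σ zⁿ E‖Sⁿ‖` has infinite radius of convergence), then any probability measure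
`ν` on grouplike elements with integrable coordinates and the same expected
signature as `μ` coincides with `μ`: the expected signature determines the law. -/
theorem expected_signature_determines_law_infinite_radius {d : ℕ} (hd : 1 ≤ d)
    (μ ν : Measure (List (Fin d) → ℝ))
    [IsProbabilityMeasure μ] [IsProbabilityMeasure ν]
    (hμG : μ {x | ¬ IsGrouplike x} = 0) (hνG : ν {x | ¬ IsGrouplike x} = 0)
    (hradius : ∀ r : ℝ, 0 < r →
      (∑' n : ℕ, ENNReal.ofReal (r ^ n) * ∫⁻ x, ENNReal.ofReal (levelNorm x n) ∂μ) < ⊤)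
    (hνint : ∀ w : List (Fin d), Integrable (fun x => x w) ν)
    (hexp : ∀ w : List (Fin d), ∫ x, x w ∂ν = ∫ x, x w ∂μ) :
    ν = μ := by
  have hμG' : ∀ᵐ x ∂μ, IsGrouplike x := ae_iff.2 hμG
  have hνG' : ∀ᵐ x ∂ν, IsGrouplike x := ae_iff.2 hνG
  have hμ := hasMomentDecay_of_radius hradius
  have hν := hμ.of_integral_eq hνG' hνint hexp
  exact measure_ext_of_integral_cexp_coordinates fun I s =>
    integral_cexp_coordinates_eq hμ hν hμG' hνG' hexp (fun i : I => (i : List (Fin d))) s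
end

section
/- (Developments into the unitary group are bounded.) Let ψ : ℝ^m → Matrix (Fin d) (Fin d) ℂ be a real-linear map whose values are skew-Hermitian matrices (ψ(e)ᴴ = −ψ(e) for all e ∈ ℝ^m). Let γ : [a,b] → ℝ^m be a C¹ path, and let Ψ : [a,b] → Matrix (Fin d) (Fin d) ℂ be differentiable with Ψ'(t) = ψ(γ'(t)) * Ψ(t) for all t ∈ [a,b], with Ψ(a) a unitary matrix. Then Ψ(t) is unitary for every t ∈ [a,b]; in particular the development Ψ remains bounded (operator norm 1) regardless of the length of γ. -/
open MeasureTheory Set Filter Matrix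

attribute [local instance] Matrix.normedAddCommGroup Matrix.normedSpace

/-- If `Ψ' = A Ψ` at `t` with `A` skew-Hermitian, then `Ψᴴ Ψ` has zero derivative at `t`. -/
theorem hasDerivAt_conjTranspose_mul_self_zero {n : Type*} [Fintype n]
    {Ψ : ℝ → Matrix n n ℂ} {A : Matrix n n ℂ} {t : ℝ}
    (hA : Aᴴ = -A) (hΨ : HasDerivAt Ψ (A * Ψ t) t) :
    HasDerivAt (fun s => (Ψ s)ᴴ * Ψ s) 0 t := by
  have entry (i j : n) : HasDerivAt (fun s => Ψ s i j) ((A * Ψ t) i j) t :=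
    hasDerivAt_pi.1 (hasDerivAt_pi.1 hΨ i) j
  have product : (A * Ψ t)ᴴ * Ψ t + (Ψ t)ᴴ * (A * Ψ t) = 0 := by
    rw [conjTranspose_mul, hA]
    simp [Matrix.mul_assoc]
  refine hasDerivAt_pi.2 fun i => hasDerivAt_pi.2 fun j => ?_
  have hsum : HasDerivAt (fun s => ∑ k, star (Ψ s k i) * Ψ s k j)
      (∑ k, (star ((A * Ψ t) k i) * Ψ t k j + star (Ψ t k i) * (A * Ψ t) k j)) t :=
    HasDerivAt.fun_sum fun k _ => (entry k i).star.mul (entry k j)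
  rw [Finset.sum_add_distrib] at hsum
  exact hsum.congr_deriv (congrFun (congrFun product i) j)

/-- Developments into the unitary group are bounded: if `ψ` is a real-linear
map from `ℝ^m` into the skew-Hermitian `d×d` complex matrices and `Ψ` solves
the linear controlled differential equation `dΨ_t = ψ(dγ_t) Ψ_t` along a C¹
path `γ` with unitary initial condition, then `Ψ(t)` is unitary for all
`t ∈ [a,b]`; in particular the development stays bounded regardless of the
length of `γ`. -/
theorem development_into_unitary_group_stays_unitary {m d : ℕ}
    (ψ : EuclideanSpace ℝ (Fin m) →ₗ[ℝ] Matrix (Fin d) (Fin d) ℂ)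
    (hψ : ∀ e, (ψ e)ᴴ = -(ψ e))
    (γ : ℝ → EuclideanSpace ℝ (Fin m)) (a b : ℝ) (hab : a ≤ b)
    (hγ : ContDiff ℝ 1 γ)
    (Ψ : ℝ → Matrix (Fin d) (Fin d) ℂ)
    (hΨ : ∀ t ∈ Set.Icc a b, HasDerivAt Ψ (ψ (deriv γ t) * Ψ t) t)
    (hU : Ψ a ∈ Matrix.unitaryGroup (Fin d) ℂ) :
    ∀ t ∈ Set.Icc a b, Ψ t ∈ Matrix.unitaryGroup (Fin d) ℂ := by
  have deriv_zero (t : ℝ) (ht : t ∈ Icc a b) :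
      HasDerivAt (fun s => (Ψ s)ᴴ * Ψ s) 0 t :=
    hasDerivAt_conjTranspose_mul_self_zero (hψ _) (hΨ t ht)
  intro t ht
  rw [mem_unitaryGroup_iff', star_eq_conjTranspose] at hU ⊢
  rw [← hU]
  exact constant_of_has_deriv_right_zero
    (fun s hs => (deriv_zero s hs).continuousAt.continuousWithinAt)
    (fun s hs => (deriv_zero s (Ico_subset_Icc_self hs)).hasDerivWithinAt) t ht
end

section
/- Let Z be a standard Gaussian random variable (law N(0,1) on ℝ). Although the law of Z³ alone is not determined by its moments, the pair (Z, Z³) is: if (X,Y) is an ℝ²-valued random vector such that E[X^m Y^n] exists and equals E[Z^{m+3n}] for all natural numbers m, n, then the law of (X,Y) equals the law of (Z, Z³). -/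
open MeasureTheory ProbabilityTheory

/-- The integral of `cosh (t * x)` is determined by the even moments. -/
lemma lintegral_cosh_eq_tsum_moments (μ : Measure ℝ)
    (hμ : ∀ n : ℕ, Integrable (fun x : ℝ => x ^ n) μ) (t : ℝ) :
    ∫⁻ x, ENNReal.ofReal (Real.cosh (t * x)) ∂μ
      = ∑' n : ℕ, ENNReal.ofReal (t ^ (2 * n) / (2 * n).factorial * ∫ x, x ^ (2 * n) ∂μ) := by
  have hnonneg (n : ℕ) (x : ℝ) : 0 ≤ t ^ (2 * n) / (2 * n).factorial * x ^ (2 * n) := by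
    have h₁ : 0 ≤ t ^ (2 * n) := (even_two_mul n).pow_nonneg t
    have h₂ : 0 ≤ x ^ (2 * n) := (even_two_mul n).pow_nonneg x
    positivity
  have hsum (x : ℝ) : HasSum (fun n : ℕ => t ^ (2 * n) / (2 * n).factorial * x ^ (2 * n))
      (Real.cosh (t * x)) := by
    convert Real.hasSum_cosh (t * x) using 2 with n
    rw [mul_pow]
    ring
  calc ∫⁻ x, ENNReal.ofReal (Real.cosh (t * x)) ∂μ
      = ∫⁻ x, ∑' n : ℕ,
          ENNReal.ofReal (t ^ (2 * n) / (2 * n).factorial * x ^ (2 * n)) ∂μ := by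
        refine lintegral_congr fun x => ?_
        rw [← (hsum x).tsum_eq, ENNReal.ofReal_tsum_of_nonneg (hnonneg · x) (hsum x).summable]
    _ = ∑' n : ℕ, ∫⁻ x,
          ENNReal.ofReal (t ^ (2 * n) / (2 * n).factorial * x ^ (2 * n)) ∂μ :=
        lintegral_tsum fun n => by fun_prop
    _ = _ := by
        refine tsum_congr fun n => ?_
        rw [← integral_const_mul, ofReal_integral_eq_lintegral_ofReal ((hμ _).const_mul _)
          (ae_of_all _ (hnonneg n))]

/-- If all exponential moments exist, the characteristic function is the sum of the
moment series. -/
lemma hasSum_charFun_of_integrable_exp_abs (μ : Measure ℝ) (t : ℝ)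
    (hexp : Integrable (fun x : ℝ => Real.exp |t * x|) μ) :
    HasSum (fun n : ℕ => ((t : ℂ) * Complex.I) ^ n / n.factorial * ((∫ x, x ^ n ∂μ : ℝ) : ℂ))
      (charFun μ t) := by
  have hsum (x : ℝ) : HasSum (fun n : ℕ => |t * x| ^ n / n.factorial) (Real.exp |t * x|) := by
    rw [Real.exp_eq_exp_ℝ]
    exact NormedSpace.expSeries_div_hasSum_exp _
  have key := hasSum_integral_of_dominated_convergence (μ := μ)
    (F := fun (n : ℕ) (x : ℝ) => ((t : ℂ) * Complex.I) ^ n / n.factorial * ((x ^ n : ℝ) : ℂ))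
    (f := fun x : ℝ => Complex.exp (t * x * Complex.I))
    (fun n x => |t * x| ^ n / n.factorial)
    (fun n => by fun_prop)
    (fun n => ae_of_all _ fun x => by
      refine le_of_eq ?_
      simp [abs_mul, mul_pow]
      ring)
    (ae_of_all _ fun x => (hsum x).summable)
    (by simpa only [(hsum _).tsum_eq] using hexp)
    (ae_of_all _ fun x => by
      rw [Complex.exp_eq_exp_ℂ]
      have hseries := NormedSpace.expSeries_div_hasSum_exp ((t : ℂ) * x * Complex.I)
      rw [show (fun n : ℕ => ((t : ℂ) * x * Complex.I) ^ n / n.factorial) =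
          fun n => ((t : ℂ) * Complex.I) ^ n / n.factorial * ((x ^ n : ℝ) : ℂ) from
        funext fun n => by push_cast; ring] at hseries
      exact hseries)
  rw [charFun_apply_real]
  simpa only [integral_const_mul, integral_complex_ofReal] using key

/-- A finite measure on `ℝ` with all exponential moments is determined by its moments. -/
lemma Measure.ext_of_moments_of_integrable_exp (μ ν : Measure ℝ) [IsFiniteMeasure μ]
    [IsFiniteMeasure ν] (hexp : ∀ t : ℝ, Integrable (fun x : ℝ => Real.exp (t * x)) ν)
    (hμ : ∀ n : ℕ, Integrable (fun x : ℝ => x ^ n) μ)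
    (hν : ∀ n : ℕ, Integrable (fun x : ℝ => x ^ n) ν)
    (h : ∀ n : ℕ, ∫ x, x ^ n ∂μ = ∫ x, x ^ n ∂ν) : μ = ν := by
  have hcoshν (t : ℝ) : Integrable (fun x : ℝ => Real.cosh (t * x)) ν := by
    have := ((hexp t).add (hexp (-t))).div_const 2
    simpa [Real.cosh_eq] using this
  have hcoshμ (t : ℝ) : Integrable (fun x : ℝ => Real.cosh (t * x)) μ := by
    have hpos (ρ : Measure ℝ) : 0 ≤ᵐ[ρ] fun x : ℝ => Real.cosh (t * x) :=
      ae_of_all _ fun x => (Real.cosh_pos _).le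
    refine ⟨by fun_prop, ?_⟩
    rw [hasFiniteIntegral_iff_ofReal (hpos μ), lintegral_cosh_eq_tsum_moments μ hμ]
    simp only [h]
    rw [← lintegral_cosh_eq_tsum_moments ν hν, ← hasFiniteIntegral_iff_ofReal (hpos ν)]
    exact (hcoshν t).2
  have hexp_abs (ρ : Measure ℝ) (t : ℝ) (hρ : Integrable (fun x : ℝ => Real.cosh (t * x)) ρ) :
      Integrable (fun x : ℝ => Real.exp |t * x|) ρ := by
    refine (hρ.const_mul 2).mono' (by fun_prop) (ae_of_all _ fun x => ?_)
    rw [Real.norm_of_nonneg (Real.exp_pos _).le, ← Real.cosh_abs, Real.cosh_eq]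
    linarith [Real.exp_pos (-|t * x|)]
  refine Measure.ext_of_charFun (funext fun t => ?_)
  have hsumμ := hasSum_charFun_of_integrable_exp_abs μ t (hexp_abs μ t (hcoshμ t))
  have hsumν := hasSum_charFun_of_integrable_exp_abs ν t (hexp_abs ν t (hcoshν t))
  simp only [h] at hsumμ
  exact hsumμ.unique hsumν

/-- Moment determinacy of the pair `(Z, Z³)` for `Z` standard Gaussian: if an
`ℝ²`-valued random vector `(X,Y)` (given by its joint law `ρ`) has all joint
moments `E[X^m Y^n]` existing and equal to `E[Z^{m+3n}]`, then the law of
`(X,Y)` is the law of `(Z, Z³)`, i.e. the pushforward of `N(0,1)` under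
`z ↦ (z, z³)`. -/
theorem pair_with_cube_is_moment_determinate
    (ρ : Measure (ℝ × ℝ)) [IsProbabilityMeasure ρ]
    (hmom : ∀ m n : ℕ,
      Integrable (fun p : ℝ × ℝ => p.1 ^ m * p.2 ^ n) ρ ∧
      ∫ p, p.1 ^ m * p.2 ^ n ∂ρ = ∫ z, z ^ (m + 3 * n) ∂(gaussianReal 0 1)) :
    ρ = Measure.map (fun z : ℝ => (z, z ^ 3)) (gaussianReal 0 1) := by
  have hfst : ρ.map Prod.fst = gaussianReal 0 1 := by
    have : IsProbabilityMeasure (ρ.map Prod.fst) :=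
      Measure.isProbabilityMeasure_map (by fun_prop)
    refine Measure.ext_of_moments_of_integrable_exp _ _
      (fun t => integrable_exp_mul_gaussianReal t) (fun n => ?_) (fun n => ?_) (fun n => ?_)
    · rw [integrable_map_measure (by fun_prop) (by fun_prop)]
      simpa [Function.comp_def] using (hmom n 0).1
    · refine integrable_pow_of_integrable_exp_mul (t := 1) one_ne_zero ?_ ?_ n
      · exact integrable_exp_mul_gaussianReal 1
      · exact integrable_exp_mul_gaussianReal (-1)
    · rw [integral_map (by fun_prop) (by fun_prop)]
      simpa using (hmom n 0).2
  have hcurve : ∀ᵐ p ∂ρ, p.2 = p.1 ^ 3 := by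
    have hexpand : (fun p : ℝ × ℝ => (p.2 - p.1 ^ 3) ^ 2) = fun p =>
        p.1 ^ 0 * p.2 ^ 2 - 2 * (p.1 ^ 3 * p.2 ^ 1) + p.1 ^ 6 * p.2 ^ 0 := by
      funext p
      ring
    have hsub : Integrable
        (fun p : ℝ × ℝ => p.1 ^ 0 * p.2 ^ 2 - 2 * (p.1 ^ 3 * p.2 ^ 1)) ρ :=
      (hmom 0 2).1.sub ((hmom 3 1).1.const_mul 2)
    have hzero : ∫ p, (p.2 - p.1 ^ 3) ^ 2 ∂ρ = 0 := by
      rw [hexpand, integral_add hsub (hmom 6 0).1,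
        integral_sub (hmom 0 2).1 ((hmom 3 1).1.const_mul 2), integral_const_mul,
        (hmom 0 2).2, (hmom 3 1).2, (hmom 6 0).2]
      norm_num
      ring
    rw [integral_eq_zero_iff_of_nonneg (fun p => sq_nonneg _) (by rw [hexpand]; exact hsub.add (hmom 6 0).1)]
      at hzero
    filter_upwards [hzero] with p hp
    exact sub_eq_zero.mp (pow_eq_zero_iff two_ne_zero |>.mp hp)
  calc ρ = ρ.map id := Measure.map_id.symm
    _ = ρ.map ((fun z : ℝ => (z, z ^ 3)) ∘ Prod.fst) :=
        Measure.map_congr <| by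
          filter_upwards [hcurve] with p hp
          exact Prod.ext rfl hp
    _ = (ρ.map Prod.fst).map (fun z : ℝ => (z, z ^ 3)) :=
        (Measure.map_map (by fun_prop) (by fun_prop)).symm
    _ = _ := by rw [hfst]
end

section
/- Let Z be a standard Gaussian random variable and let (X,Y) be an ℝ²-valued random vector whose joint moments E[X^m Y^n] exist and agree with E[Z^{m+3n}] for all natural numbers m, n with m + 3n ≤ 6. Then E[(Y − X³)²] = 0, and hence Y = X³ almost surely. -/
open MeasureTheory ProbabilityTheory

/-- If the joint law `ρ` of an `ℝ²`-valued random vector `(X,Y)` has joint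
moments `E[X^m Y^n]` existing and agreeing with `E[Z^{m+3n}]` (for `Z` standard
Gaussian) whenever `m + 3n ≤ 6`, then `E[(Y − X³)²] = 0` and hence `Y = X³`
almost surely. -/
theorem low_moments_force_cube_relation
    (ρ : Measure (ℝ × ℝ)) [IsProbabilityMeasure ρ]
    (hmom : ∀ m n : ℕ, m + 3 * n ≤ 6 →
      Integrable (fun p : ℝ × ℝ => p.1 ^ m * p.2 ^ n) ρ ∧
      ∫ p, p.1 ^ m * p.2 ^ n ∂ρ = ∫ z, z ^ (m + 3 * n) ∂(gaussianReal 0 1)) :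
    (∫ p, (p.2 - p.1 ^ 3) ^ 2 ∂ρ) = 0 ∧ ∀ᵐ p ∂ρ, p.2 = p.1 ^ 3 := by
  obtain ⟨i₁, e₁⟩ := hmom 0 2 (by norm_num)
  obtain ⟨i₂, e₂⟩ := hmom 3 1 (by norm_num)
  obtain ⟨i₃, e₃⟩ := hmom 6 0 (by norm_num)
  have expand : (fun p : ℝ × ℝ => (p.2 - p.1 ^ 3) ^ 2) =
      fun p => p.1 ^ 0 * p.2 ^ 2 - 2 * (p.1 ^ 3 * p.2 ^ 1) + p.1 ^ 6 * p.2 ^ 0 := by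
    ext p
    ring
  have integrable_sq : Integrable (fun p : ℝ × ℝ => (p.2 - p.1 ^ 3) ^ 2) ρ := by
    rw [expand]
    exact (i₁.sub (i₂.const_mul 2)).add i₃
  have integral_sq : ∫ p, (p.2 - p.1 ^ 3) ^ 2 ∂ρ = 0 := by
    rw [expand, integral_add (by exact i₁.sub (i₂.const_mul 2)) i₃,
      integral_sub i₁ (i₂.const_mul 2), integral_const_mul, e₁, e₂, e₃]
    ring
  refine ⟨integral_sq, ?_⟩
  filter_upwards [(integral_eq_zero_iff_of_nonneg (fun p => sq_nonneg _) integrable_sq).mp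
    integral_sq] with p hp
  exact sub_eq_zero.mp (sq_eq_zero_iff.mp hp)
end
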